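/- arXiv:2605.18620 — 2 statements merged into one kernel-verified Lean document; each statement's English description precedes it below -/
import Mathlib

section
/- For 0 < u < v < 1 define p(u,v,w) := Φ( √2 [ Φ⁻¹(u) − √( (Φ⁻¹(v) − Φ⁻¹(u)) (Φ⁻¹(w) − Φ⁻¹(u)) ) ] ) for v < w < 1, and G(u,v) := (1/(1−v)) ∫_v^1 p(u,v,w) dw. For n ≥ 4 set J_n := n(n−1)(n−2) ∫₀¹ ∫_u^1 (1−w) [ (1−u)^{n−3} − (1−w)^{n−3} ] G(u,w) dw du. Then lim_{n→∞} n (log n)^{3/2} · J_n = 9√(π/2). -/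
open Filter Set

/-- The standard normal cumulative distribution function
`Φ(t) = ∫_{-∞}^t e^{-z²/2}/√(2π) dz`. -/
noncomputable def stdNormalCDF (t : ℝ) : ℝ :=
  ∫ z in Set.Iic t, Real.exp (-z ^ 2 / 2) / Real.sqrt (2 * Real.pi)

/-- The inverse function `Φ⁻¹ : (0,1) → ℝ` of the standard normal CDF. -/
noncomputable def stdNormalCDFInv : ℝ → ℝ :=
  Function.invFun stdNormalCDF

/-- The pair probability
`p(u,v,w) = Φ(√2[Φ⁻¹(u) − √((Φ⁻¹(v)−Φ⁻¹(u))(Φ⁻¹(w)−Φ⁻¹(u)))])`. -/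
noncomputable def pPair (u v w : ℝ) : ℝ :=
  stdNormalCDF (Real.sqrt 2 * (stdNormalCDFInv u -
    Real.sqrt ((stdNormalCDFInv v - stdNormalCDFInv u) *
      (stdNormalCDFInv w - stdNormalCDFInv u))))

/-- The averaged edge-probability function
`G(u,v) = (1/(1−v)) ∫_v^1 p(u,v,w) dw` (which at `v = u` coincides with the
continuous extension from `v > u`). -/
noncomputable def Gavg (u v : ℝ) : ℝ :=
  (1 / (1 - v)) * ∫ w in Set.Ioo v 1, pPair u v w

open MeasureTheory Topology

/-- Standard normal density. -/
noncomputable def nphi (z : ℝ) : ℝ := Real.exp (-z ^ 2 / 2) / Real.sqrt (2 * Real.pi)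

lemma nphi_pos (z : ℝ) : 0 < nphi z := by unfold nphi; positivity

lemma nphi_cont : Continuous nphi := by unfold nphi; fun_prop

lemma nphi_integrable : Integrable nphi := by
  have h := (integrable_exp_neg_mul_sq (b := 1/2) (by norm_num)).div_const (Real.sqrt (2 * Real.pi))
  refine h.congr (Eventually.of_forall fun x => ?_)
  simp only [nphi]
  congr 2; ring

lemma nphi_integral : ∫ z, nphi z = 1 := by
  have h : ∀ z, nphi z = Real.exp (-(1/2) * z^2) / Real.sqrt (2 * Real.pi) := by
    intro z; simp only [nphi]; congr 2; ring
  simp_rw [h]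
  rw [integral_div, integral_gaussian]
  have : Real.pi / (1/2) = 2 * Real.pi := by ring
  rw [this]
  have : 0 < Real.sqrt (2 * Real.pi) := by positivity
  field_simp

lemma nphi_neg (z : ℝ) : nphi (-z) = nphi z := by simp [nphi]

lemma Phi_eq (t : ℝ) : stdNormalCDF t = ∫ z in Iic t, nphi z := rfl

lemma Phi_sub (a b : ℝ) : stdNormalCDF b - stdNormalCDF a = ∫ z in a..b, nphi z := by
  rw [Phi_eq, Phi_eq, intervalIntegral.integral_Iic_sub_Iic nphi_integrable.integrableOn
    nphi_integrable.integrableOn]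

lemma Phi_hasDerivAt (t : ℝ) : HasDerivAt stdNormalCDF (nphi t) t := by
  have h : stdNormalCDF = fun b => stdNormalCDF 0 + ∫ z in (0:ℝ)..b, nphi z := by
    funext b; rw [← Phi_sub]; ring
  rw [h]
  refine HasDerivAt.const_add _ ?_
  exact intervalIntegral.integral_hasDerivAt_right (nphi_cont.intervalIntegrable _ _)
    (nphi_cont.stronglyMeasurableAtFilter _ _) nphi_cont.continuousAt

lemma Phi_cont : Continuous stdNormalCDF :=
  continuous_iff_continuousAt.2 fun t => (Phi_hasDerivAt t).continuousAt

lemma Phi_strictMono : StrictMono stdNormalCDF :=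
  strictMono_of_hasDerivAt_pos (fun t => Phi_hasDerivAt t) (fun t => nphi_pos t)

lemma Phi_add_neg (t : ℝ) : stdNormalCDF t + stdNormalCDF (-t) = 1 := by
  have h1 : stdNormalCDF (-t) = ∫ z in Ioi t, nphi z := by
    rw [Phi_eq]
    have := integral_comp_neg_Iic (-t) nphi
    rw [neg_neg] at this
    rw [← this]; simp_rw [nphi_neg]
  rw [h1, Phi_eq, ← compl_Iic, integral_add_compl measurableSet_Iic nphi_integrable, nphi_integral]

lemma nphi_hasDerivAt (z : ℝ) : HasDerivAt nphi (-z * nphi z) z := by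
  unfold nphi
  have h : HasDerivAt (fun z : ℝ => -z^2/2) (-z) z := by
    have := ((hasDerivAt_pow 2 z).neg).div_const 2
    refine this.congr_deriv ?_
    norm_num; ring
  have := (h.exp).div_const (Real.sqrt (2 * Real.pi))
  refine this.congr_deriv ?_
  ring

lemma nphi_tendsto_atBot : Tendsto nphi atBot (𝓝 0) := by
  have h : Tendsto (fun z : ℝ => z^2/2) atBot atTop := by
    refine Tendsto.atTop_div_const (by norm_num) ?_
    have := tendsto_pow_atTop (α := ℝ) (n := 2) (by norm_num)
    have := this.comp tendsto_neg_atBot_atTop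
    refine this.congr fun x => by simp
  have h2 := (Real.tendsto_exp_neg_atTop_nhds_zero.comp h).div_const (Real.sqrt (2 * Real.pi))
  rw [zero_div] at h2
  refine h2.congr fun x => ?_
  simp [nphi, neg_div]

/-- Mills upper bound. -/
lemma Phi_le {A : ℝ} (hA : 0 < A) : stdNormalCDF (-A) ≤ nphi A / A := by
  have hi : ∫ z in Iic (-A), (-z * nphi z) = nphi (-A) - 0 := by
    refine integral_Iic_of_hasDerivAt_of_tendsto' (fun x _ => nphi_hasDerivAt x) ?_ nphi_tendsto_atBot
    have : Integrable (fun z : ℝ => z * Real.exp (-(1/2) * z^2)) :=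
      integrable_mul_exp_neg_mul_sq (by norm_num)
    have := (this.neg).div_const (Real.sqrt (2 * Real.pi))
    refine (this.congr (Eventually.of_forall fun x => ?_)).integrableOn
    simp only [nphi, Pi.neg_apply]
    have : -(1/2) * x^2 = -x^2/2 := by ring
    rw [this]; ring
  have hInteg : IntegrableOn (fun z => -z * nphi z) (Iic (-A)) := by
    by_contra h
    have := integral_undef h
    rw [this] at hi
    have := nphi_pos (-A)
    linarith
  rw [le_div_iff₀ hA, Phi_eq, ← integral_mul_const]
  rw [nphi_neg, sub_zero] at hi
  rw [← hi]
  refine setIntegral_mono_on (nphi_integrable.integrableOn.mul_const A) hInteg measurableSet_Iic ?_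
  intro z hz
  have := nphi_pos z
  simp only [mem_Iic] at hz
  nlinarith

lemma Phi_nonneg (t : ℝ) : 0 ≤ stdNormalCDF t := by
  rw [Phi_eq]; exact integral_nonneg fun z => (nphi_pos z).le

lemma Phi_pos (t : ℝ) : 0 < stdNormalCDF t :=
  lt_of_le_of_lt (Phi_nonneg (t-1)) (Phi_strictMono (by linarith))

lemma Phi_lt_one (t : ℝ) : stdNormalCDF t < 1 := by
  have := Phi_add_neg t; have := Phi_pos (-t); linarith

/-- Mills lower bound. -/
lemma Phi_ge {A : ℝ} (hA : 0 < A) : nphi A * A / (1 + A^2) ≤ stdNormalCDF (-A) := by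
  have hd : ∀ x < 0, HasDerivAt (fun z => - nphi z / z) (nphi x + nphi x / x^2) x := by
    intro x hx
    have := ((nphi_hasDerivAt x).neg).div (hasDerivAt_id x) hx.ne
    refine this.congr_deriv ?_
    have hx' := hx.ne
    simp only [id, Pi.neg_apply]
    field_simp
    ring
  have hInteg : IntegrableOn (fun x => nphi x + nphi x / x^2) (Iic (-A)) := by
    refine Integrable.add nphi_integrable.integrableOn ?_
    refine Integrable.mono' (g := fun x => nphi x / A^2) (nphi_integrable.integrableOn.div_const _) ?_ ?_
    · exact (nphi_cont.measurable.div (by fun_prop)).aestronglyMeasurable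
    · refine (ae_restrict_iff' measurableSet_Iic).2 (Eventually.of_forall fun x hx => ?_)
      have := nphi_pos x
      simp only [mem_Iic] at hx
      rw [Real.norm_of_nonneg (by positivity)]
      refine div_le_div_of_nonneg_left this.le (by positivity) ?_
      nlinarith
  have hi : ∫ z in Iic (-A), (nphi z + nphi z / z^2) = (- nphi (-A) / (-A)) - 0 := by
    refine integral_Iic_of_hasDerivAt_of_tendsto' (f := fun z => - nphi z / z)
      (fun x hx => hd x (by simp only [mem_Iic] at hx; linarith)) hInteg ?_
    have h1 : Tendsto (fun z : ℝ => z⁻¹) atBot (𝓝 0) := tendsto_inv_atBot_zero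
    have := (nphi_tendsto_atBot.neg).mul h1
    simpa [div_eq_mul_inv] using this
  have hle : ∫ z in Iic (-A), (nphi z + nphi z / z^2) ≤ ∫ z in Iic (-A), nphi z * (1 + 1/A^2) := by
    refine setIntegral_mono_on hInteg (nphi_integrable.integrableOn.mul_const _) measurableSet_Iic ?_
    intro z hz
    have := nphi_pos z
    simp only [mem_Iic] at hz
    rw [mul_add, mul_one, mul_one_div]
    refine add_le_add le_rfl (div_le_div_of_nonneg_left this.le (by positivity) ?_)
    nlinarith
  rw [integral_mul_const, hi, ← Phi_eq, nphi_neg] at hle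
  rw [div_le_iff₀ (by positivity)]
  have e : - nphi A / -A - 0 = nphi A / A := by field_simp; simp
  rw [e, div_le_iff₀ hA] at hle
  have e2 : stdNormalCDF (-A) * (1 + A^2) = stdNormalCDF (-A) * (1 + 1/A^2) * A * A := by
    field_simp; ring
  rw [e2]
  gcongr

lemma Phi_tendsto_atBot : Tendsto stdNormalCDF atBot (𝓝 0) := by
  refine squeeze_zero' (Eventually.of_forall Phi_nonneg) ?_ nphi_tendsto_atBot
  filter_upwards [eventually_le_atBot (-1)] with x hx
  have h := Phi_le (A := -x) (by linarith)
  rw [neg_neg, nphi_neg] at h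
  refine h.trans (div_le_self (nphi_pos x).le (by linarith))

lemma Phi_tendsto_atTop : Tendsto stdNormalCDF atTop (𝓝 1) := by
  have h := (Phi_tendsto_atBot.comp tendsto_neg_atTop_atBot).const_sub 1
  rw [sub_zero] at h
  refine h.congr fun x => ?_
  have := Phi_add_neg x
  simp only [Function.comp]; linarith

lemma Phi_surj {u : ℝ} (h0 : 0 < u) (h1 : u < 1) : ∃ t, stdNormalCDF t = u := by
  obtain ⟨a, ha⟩ := (Phi_tendsto_atBot.eventually (gt_mem_nhds h0)).exists
  obtain ⟨b, hb⟩ := (Phi_tendsto_atTop.eventually (lt_mem_nhds h1)).exists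
  exact mem_range_of_exists_le_of_exists_ge Phi_cont ⟨a, ha.le⟩ ⟨b, hb.le⟩

lemma Pinv_Phi (t : ℝ) : stdNormalCDFInv (stdNormalCDF t) = t :=
  Function.leftInverse_invFun Phi_strictMono.injective t

lemma Phi_Pinv {u : ℝ} (h0 : 0 < u) (h1 : u < 1) : stdNormalCDF (stdNormalCDFInv u) = u := by
  obtain ⟨t, rfl⟩ := Phi_surj h0 h1
  rw [Pinv_Phi]

lemma Pinv_measurable : Measurable stdNormalCDFInv := by
  have he : MeasurableEmbedding stdNormalCDF := Phi_cont.measurableEmbedding Phi_strictMono.injective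
  have : stdNormalCDFInv = Function.extend stdNormalCDF id
      (fun _ => Classical.choice (inferInstance : Nonempty ℝ)) := by
    funext y
    by_cases hy : ∃ t, stdNormalCDF t = y
    · obtain ⟨t, rfl⟩ := hy
      rw [Pinv_Phi, Phi_strictMono.injective.extend_apply]; rfl
    · rw [Function.extend_apply' _ _ _ hy]
      exact Function.invFun_neg hy
  rw [this]
  exact he.measurable_extend measurable_id measurable_const

lemma Phi_le_exp {A b : ℝ} (hA : 0 < A) :
    stdNormalCDF (-A + b) ≤ 2 * Real.exp (-A^2/2 + A * b) := by
  rcases le_or_gt b (A - 1) with h | h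
  · have h1 := Phi_le (A := A - b) (by linarith)
    have h2 : -(A - b) = -A + b := by ring
    rw [h2] at h1
    refine h1.trans ((div_le_self (nphi_pos _).le (by linarith)).trans ?_)
    unfold nphi
    have h3 : 1 ≤ Real.sqrt (2 * Real.pi) := by
      rw [Real.one_le_sqrt]; have := Real.pi_gt_three; linarith
    refine (div_le_self (Real.exp_pos _).le h3).trans ?_
    have : Real.exp (-(A-b)^2/2) ≤ Real.exp (-A^2/2 + A*b) := by
      apply Real.exp_le_exp.2; nlinarith [sq_nonneg b]
    linarith [Real.exp_pos (-A^2/2 + A*b)]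
  · have h1 : Real.exp (-1/2) ≤ Real.exp (-A^2/2 + A*b) := by
      apply Real.exp_le_exp.2; nlinarith [sq_nonneg (A-1)]
    have h2 : (-1/2:ℝ) + 1 ≤ Real.exp (-1/2) := Real.add_one_le_exp _
    have := Phi_lt_one (-A+b)
    linarith

/-- the normalised Mills ratio tends to one -/
lemma Mills_tendsto : Tendsto (fun A => A * stdNormalCDF (-A) / nphi A) atTop (𝓝 1) := by
  have h1 : Tendsto (fun A : ℝ => 1 - 1 / (1 + A^2)) atTop (𝓝 1) := by
    have : Tendsto (fun A : ℝ => 1 + A^2) atTop atTop :=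
      tendsto_atTop_add_const_left _ _ (tendsto_pow_atTop (by norm_num))
    have := (this.const_div_atTop 1).const_sub 1
    simpa using this
  refine tendsto_of_tendsto_of_tendsto_of_le_of_le' h1 tendsto_const_nhds ?_ ?_
  · filter_upwards [eventually_gt_atTop 0] with A hA
    have h := Phi_ge hA
    have hp := nphi_pos A
    rw [le_div_iff₀ hp]
    calc (1 - 1/(1+A^2)) * nphi A = A * (nphi A * A / (1 + A^2)) := by field_simp; ring
      _ ≤ _ := by gcongr
  · filter_upwards [eventually_gt_atTop 0] with A hA
    have h := Phi_le hA
    have hp := nphi_pos A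
    rw [div_le_one hp]
    rw [le_div_iff₀ hA] at h
    linarith


/-- `H(u,w) = (1-w) G(u,w)`. -/
noncomputable def Hfun (u w : ℝ) : ℝ := ∫ s in Ioo w 1, pPair u w s

lemma pPair_pos (u w s : ℝ) : 0 < pPair u w s := Phi_pos _
lemma pPair_le_one (u w s : ℝ) : pPair u w s ≤ 1 := (Phi_lt_one _).le

lemma pPair_measurable : Measurable (fun q : (ℝ × ℝ) × ℝ => pPair q.1.1 q.1.2 q.2) := by
  unfold pPair
  have h1 : Measurable (fun q : (ℝ × ℝ) × ℝ => stdNormalCDFInv q.1.1) :=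
    Pinv_measurable.comp (by fun_prop)
  have h2 : Measurable (fun q : (ℝ × ℝ) × ℝ => stdNormalCDFInv q.1.2) :=
    Pinv_measurable.comp (by fun_prop)
  have h3 : Measurable (fun q : (ℝ × ℝ) × ℝ => stdNormalCDFInv q.2) :=
    Pinv_measurable.comp (by fun_prop)
  refine Phi_cont.measurable.comp ?_
  exact (h1.sub (((h2.sub h1).mul (h3.sub h1)).sqrt)).const_mul _

lemma pPair_measurable_s (u w : ℝ) : Measurable (fun s => pPair u w s) :=
  pPair_measurable.comp ((measurable_const (a := (u, w))).prodMk measurable_id)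

lemma Hfun_measurable : Measurable (fun q : ℝ × ℝ => Hfun q.1 q.2) := by
  have h : (fun q : ℝ × ℝ => Hfun q.1 q.2) = fun q => ∫ s,
      ({z : (ℝ × ℝ) × ℝ | z.1.2 < z.2 ∧ z.2 < 1}.indicator
        (fun z : (ℝ × ℝ) × ℝ => pPair z.1.1 z.1.2 z.2)) (q, s) := by
    funext q
    rw [Hfun, ← integral_indicator measurableSet_Ioo]
    rfl
  rw [h]
  have hm : MeasurableSet {z : (ℝ × ℝ) × ℝ | z.1.2 < z.2 ∧ z.2 < 1} := by
    exact (measurableSet_lt (f := fun z : (ℝ × ℝ) × ℝ => z.1.2) (g := fun z => z.2) (by fun_prop)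
      (by fun_prop)).inter (measurableSet_lt (f := fun z : (ℝ × ℝ) × ℝ => z.2) (g := fun _ => 1)
      (by fun_prop) (by fun_prop))
  have hs := (pPair_measurable.indicator hm).stronglyMeasurable
  exact (StronglyMeasurable.integral_prod_right (ν := (volume : Measure ℝ))
    (f := fun (q : ℝ × ℝ) (s : ℝ) =>
      ({z : (ℝ × ℝ) × ℝ | z.1.2 < z.2 ∧ z.2 < 1}.indicator
        (fun z : (ℝ × ℝ) × ℝ => pPair z.1.1 z.1.2 z.2)) (q, s)) hs).measurable

lemma Hfun_nonneg (u w : ℝ) : 0 ≤ Hfun u w :=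
  integral_nonneg fun s => (pPair_pos u w s).le

lemma pPair_integrableOn (u w a b : ℝ) : IntegrableOn (fun s => pPair u w s) (Ioo a b) := by
  refine Integrable.mono' (g := fun _ => (1:ℝ)) (by simp) (pPair_measurable_s u w).aestronglyMeasurable
    (Eventually.of_forall fun s => ?_)
  rw [Real.norm_of_nonneg (pPair_pos u w s).le]
  exact pPair_le_one u w s

/-- generic upper bound for H -/
lemma Hfun_le_of {u w M t : ℝ} (hw : 0 ≤ w) (hw1 : w ≤ 1) (hM : 0 ≤ M) (ht : 0 ≤ t) (B : ℝ)
    (hB : 0 ≤ B)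
    (h1 : ∀ s ∈ Ioo w 1, pPair u w s ≤ M) (h2 : ∀ s ∈ Ioo w 1, t < s → pPair u w s ≤ B) :
    Hfun u w ≤ B + M * t := by
  have h : ∀ s ∈ Ioo w 1, pPair u w s ≤ B + (Ioc 0 t).indicator (fun _ => M) s := by
    intro s hs
    by_cases hst : t < s
    · have := h2 s hs hst
      have h3 : 0 ≤ (Ioc 0 t).indicator (fun _ => M) s := indicator_nonneg (fun _ _ => hM) s
      linarith
    · have : s ∈ Ioc 0 t := ⟨lt_of_le_of_lt hw hs.1, not_lt.1 hst⟩
      rw [indicator_of_mem this]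
      linarith [h1 s hs]
  have hi : Integrable ((Ioc 0 t).indicator (fun _ => M)) := by
    refine (integrable_indicator_iff measurableSet_Ioc).2 (by simp)
  calc Hfun u w ≤ ∫ s in Ioo w 1, (B + (Ioc 0 t).indicator (fun _ => M) s) := by
        refine setIntegral_mono_on (pPair_integrableOn u w w 1) ?_ measurableSet_Ioo h
        exact Integrable.add (by simp) hi.integrableOn
    _ = (1 - w) * B + ∫ s in Ioo w 1, (Ioc 0 t).indicator (fun _ => M) s := by
        rw [integral_add (by simp) hi.integrableOn]
        simp [hw1]
    _ ≤ B + M * t := by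
        have e : ∫ s in Ioo w 1, (Ioc 0 t).indicator (fun _ => M) s
            ≤ ∫ s, (Ioc 0 t).indicator (fun _ => M) s :=
          setIntegral_le_integral hi (Eventually.of_forall fun s => indicator_nonneg (fun _ _ => hM) s)
        have e' : ∫ s, (Ioc 0 t).indicator (fun _ => M) s = t * M := by
          rw [integral_indicator measurableSet_Ioc]
          simp [ht]
        rw [e'] at e
        nlinarith

lemma Hfun_le_one {u w : ℝ} (hw : 0 ≤ w) (hw1 : w ≤ 1) : Hfun u w ≤ 1 := by
  have := Hfun_le_of (u := u) (M := 1) (t := 0) hw hw1 zero_le_one le_rfl 1 zero_le_one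
    (fun s _ => pPair_le_one u w s) (fun s _ _ => pPair_le_one u w s)
  linarith

lemma pPair_Phi (A b c : ℝ) : pPair (stdNormalCDF (-A)) (stdNormalCDF (-A + b)) (stdNormalCDF (-A + c))
    = stdNormalCDF (Real.sqrt 2 * (-A - Real.sqrt (b * c))) := by
  unfold pPair
  rw [Pinv_Phi, Pinv_Phi, Pinv_Phi]
  congr 5 <;> ring

lemma sqrt_two_pi_le : Real.sqrt (2 * Real.pi) ≤ 3 := by
  rw [Real.sqrt_le_left (by norm_num)]; have := Real.pi_lt_four; have := Real.pi_lt_d2; linarith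

lemma sqrt_two_pi_ge : 2 ≤ Real.sqrt (2 * Real.pi) := by
  apply Real.le_sqrt_of_sq_le; have := Real.pi_gt_three; linarith

lemma nphi_le_u {A : ℝ} (hA : 1 ≤ A) : nphi A ≤ 2 * A * stdNormalCDF (-A) := by
  have h := Phi_ge (A := A) (by linarith)
  rw [div_le_iff₀ (by positivity)] at h
  have hp := Phi_pos (-A)
  have : nphi A * A ≤ (2 * A * stdNormalCDF (-A)) * A := by
    refine h.trans ?_
    have : 1 + A^2 ≤ 2 * A * A := by nlinarith
    calc stdNormalCDF (-A) * (1 + A^2) ≤ stdNormalCDF (-A) * (2 * A * A) := by gcongr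
      _ = _ := by ring
  exact le_of_mul_le_mul_right this (by linarith)

lemma exp_le_u {A : ℝ} (hA : 1 ≤ A) : Real.exp (-A^2/2) ≤ 6 * A * stdNormalCDF (-A) := by
  have h := nphi_le_u hA
  unfold nphi at h
  have hs : 0 < Real.sqrt (2 * Real.pi) := by positivity
  rw [div_le_iff₀ hs] at h
  have hp := Phi_pos (-A)
  calc _ ≤ _ := h
    _ ≤ 2 * A * stdNormalCDF (-A) * 3 := by gcongr; exact sqrt_two_pi_le
    _ = _ := by ring

lemma p_bound {A q : ℝ} (hA : 1 ≤ A) (hq : 0 ≤ q) :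
    stdNormalCDF (Real.sqrt 2 * (-A - q)) ≤ 18 * A * stdNormalCDF (-A) ^ 2 * Real.exp (-2 * A * q) := by
  have h2 : (1:ℝ) ≤ Real.sqrt 2 := by rw [Real.one_le_sqrt]; norm_num
  have hpos : 0 < Real.sqrt 2 * (A + q) := by positivity
  have h := Phi_le hpos
  have e : Real.sqrt 2 * (-A - q) = -(Real.sqrt 2 * (A + q)) := by ring
  rw [e]
  refine h.trans ?_
  rw [div_le_iff₀ hpos]
  have e2 : nphi (Real.sqrt 2 * (A + q)) ≤ Real.exp (-A^2) * Real.exp (-2*A*q) / 2 := by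
    unfold nphi
    rw [mul_pow, Real.sq_sqrt (by norm_num), ← Real.exp_add]
    refine div_le_div₀ (Real.exp_pos _).le ?_ (by norm_num) sqrt_two_pi_ge
    apply Real.exp_le_exp.2; nlinarith [sq_nonneg q]
  have e3 : Real.exp (-A^2) ≤ 36 * A^2 * stdNormalCDF (-A)^2 := by
    have := exp_le_u hA
    have e4 : Real.exp (-A^2) = Real.exp (-A^2/2)^2 := by
      rw [← Real.exp_nat_mul]; congr 1; push_cast; ring
    rw [e4]
    calc _ ≤ (6 * A * stdNormalCDF (-A))^2 := by gcongr
      _ = _ := by ring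
  have hE := Real.exp_pos (-2*A*q)
  have hp := Phi_pos (-A)
  calc _ ≤ _ := e2
    _ ≤ (36 * A^2 * stdNormalCDF (-A)^2) * Real.exp (-2*A*q) / 2 := by gcongr
    _ = 18 * A * stdNormalCDF (-A)^2 * Real.exp (-2*A*q) * A := by ring
    _ ≤ _ := by
      gcongr
      nlinarith

lemma s_param {A b s : ℝ} (hs : s ∈ Ioo (stdNormalCDF (-A + b)) 1) :
    ∃ c, b < c ∧ s = stdNormalCDF (-A + c) := by
  obtain ⟨t, rfl⟩ := Phi_surj ((Phi_pos _).trans hs.1) hs.2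
  refine ⟨t + A, ?_, by congr 1; ring⟩
  have := Phi_strictMono.lt_iff_lt.1 hs.1
  linarith

lemma H_bound1 {A b : ℝ} (hA : 1 ≤ A) (hb : 0 ≤ b) :
    Hfun (stdNormalCDF (-A)) (stdNormalCDF (-A + b)) ≤
      18 * A * stdNormalCDF (-A) ^ 2 * Real.exp (-2 * A * b) := by
  have hp := Phi_pos (-A)
  have key : ∀ s ∈ Ioo (stdNormalCDF (-A + b)) 1, pPair (stdNormalCDF (-A)) (stdNormalCDF (-A + b)) s
      ≤ 18 * A * stdNormalCDF (-A) ^ 2 * Real.exp (-2 * A * b) := by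
    intro s hs
    obtain ⟨c, hc, rfl⟩ := s_param hs
    rw [pPair_Phi]
    refine (p_bound hA (Real.sqrt_nonneg _)).trans ?_
    have : b ≤ Real.sqrt (b * c) := Real.le_sqrt_of_sq_le (by nlinarith)
    gcongr _ * Real.exp ?_
    nlinarith
  have := Hfun_le_of (t := 0) (Phi_nonneg (-A+b)) (Phi_lt_one _).le (by positivity) le_rfl _
    (by positivity) key (fun s hs _ => key s hs)
  linarith

lemma H_bound2 {A b : ℝ} (hA : 1 ≤ A) (hb : 0 ≤ b) :
    Hfun (stdNormalCDF (-A)) (stdNormalCDF (-A + b)) ≤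
      18 * A * stdNormalCDF (-A) ^ 2 * (Real.exp (-2 * A * Real.sqrt (b * (A/2)))
        + 2 * Real.exp (-A^2/8)) := by
  have hp := Phi_pos (-A)
  have key : ∀ s ∈ Ioo (stdNormalCDF (-A + b)) 1, pPair (stdNormalCDF (-A)) (stdNormalCDF (-A + b)) s
      ≤ 18 * A * stdNormalCDF (-A) ^ 2 := by
    intro s hs
    obtain ⟨c, hc, rfl⟩ := s_param hs
    rw [pPair_Phi]
    refine (p_bound hA (Real.sqrt_nonneg _)).trans ?_
    have : Real.exp (-2 * A * Real.sqrt (b * c)) ≤ 1 := by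
      apply Real.exp_le_one_iff.2
      have := Real.sqrt_nonneg (b*c); nlinarith
    exact mul_le_of_le_one_right (by positivity) this
  have key2 : ∀ s ∈ Ioo (stdNormalCDF (-A + b)) 1, stdNormalCDF (-A + A/2) < s →
      pPair (stdNormalCDF (-A)) (stdNormalCDF (-A + b)) s
      ≤ 18 * A * stdNormalCDF (-A) ^ 2 * Real.exp (-2 * A * Real.sqrt (b * (A/2))) := by
    intro s hs hs2
    obtain ⟨c, hc, rfl⟩ := s_param hs
    have hc2 : A/2 < c := by
      have := Phi_strictMono.lt_iff_lt.1 hs2; linarith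
    rw [pPair_Phi]
    refine (p_bound hA (Real.sqrt_nonneg _)).trans ?_
    have : Real.sqrt (b * (A/2)) ≤ Real.sqrt (b * c) := Real.sqrt_le_sqrt (by gcongr)
    gcongr _ * Real.exp ?_
    nlinarith
  have := Hfun_le_of (Phi_nonneg (-A+b)) (Phi_lt_one _).le (by positivity) (Phi_nonneg (-A + A/2)) _
    (by positivity) key key2
  have h3 : stdNormalCDF (-A + A/2) ≤ 2 * Real.exp (-A^2/8) := by
    have h := Phi_le_exp (A := A/2) (b := 0) (by linarith)
    have e1 : -(A/2) + 0 = -A + A/2 := by ring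
    have e2 : -(A/2)^2/2 + A/2 * 0 = -A^2/8 := by ring
    rwa [e1, e2] at h
  refine this.trans ?_
  rw [mul_add]
  gcongr

lemma nphi_mono {x y : ℝ} (h : y^2 ≤ x^2) : nphi x ≤ nphi y := by
  unfold nphi
  gcongr

lemma Phi_slope {a b : ℝ} (h : a < b) : ∃ c ∈ Ioo a b, stdNormalCDF b - stdNormalCDF a = (b - a) * nphi c := by
  obtain ⟨c, hc, h2⟩ := exists_hasDerivAt_eq_slope stdNormalCDF nphi h Phi_cont.continuousOn
    (fun x _ => Phi_hasDerivAt x)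
  refine ⟨c, hc, ?_⟩
  have : b - a ≠ 0 := by linarith
  rw [h2]; field_simp

lemma diff_lower {A b : ℝ} (hb : 0 ≤ b) (hbA : b ≤ A) :
    b * nphi A ≤ stdNormalCDF (-A + b) - stdNormalCDF (-A) := by
  rcases hb.eq_or_lt with rfl | hb
  · simp
  obtain ⟨c, hc, h⟩ := Phi_slope (a := -A) (b := -A + b) (by linarith)
  rw [h]
  have e : -A + b - -A = b := by ring
  rw [e]
  gcongr
  apply nphi_mono; nlinarith [hc.1, hc.2]

lemma diff_upper {A b : ℝ} (hb : 0 ≤ b) (hbA : b ≤ A) :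
    stdNormalCDF (-A + b) - stdNormalCDF (-A) ≤ b * nphi A * Real.exp (A * b) := by
  rcases hb.eq_or_lt with rfl | hb
  · simp
  obtain ⟨c, hc, h⟩ := Phi_slope (a := -A) (b := -A + b) (by linarith)
  rw [h]
  have e : -A + b - -A = b := by ring
  rw [e, mul_assoc]
  gcongr
  have h1 : nphi c ≤ nphi (-A + b) := by
    apply nphi_mono; nlinarith [hc.1, hc.2]
  refine h1.trans ?_
  unfold nphi
  rw [div_mul_eq_mul_div, ← Real.exp_add]
  gcongr
  nlinarith [sq_nonneg b]

lemma diff_bound {A b : ℝ} (hA : 1 ≤ A) (hb : 0 ≤ b) :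
    stdNormalCDF (-A + b) - stdNormalCDF (-A) ≤ 6 * (A * b) * stdNormalCDF (-A) ∨ 1 < A * b := by
  rcases le_or_gt (A * b) 1 with h | h
  · left
    have hbA : b ≤ A := by nlinarith
    have h1 := diff_upper hb hbA
    have h2 := nphi_le_u hA
    have h3 : Real.exp (A * b) ≤ 3 := by
      refine (Real.exp_le_exp.2 h).trans ?_
      have := Real.exp_one_lt_d9; linarith
    have hp := Phi_pos (-A)
    calc _ ≤ _ := h1
      _ ≤ b * (2 * A * stdNormalCDF (-A)) * 3 := by gcongr
      _ = _ := by ring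
  · exact Or.inr h

lemma w_param {A w : ℝ} (h1 : stdNormalCDF (-A) ≤ w) (h2 : w < 1) :
    ∃ b, 0 ≤ b ∧ w = stdNormalCDF (-A + b) := by
  obtain ⟨t, rfl⟩ := Phi_surj ((Phi_pos _).trans_le h1) h2
  refine ⟨t + A, ?_, by congr 1; ring⟩
  have := Phi_strictMono.le_iff_le.1 h1
  linarith

lemma H_near {A r : ℝ} (hA : 4 ≤ A) (hr : 0 ≤ r) (hr1 : r ≤ 1)
    (hw : stdNormalCDF (-A) * (1 + r) < 1) :
    Hfun (stdNormalCDF (-A)) (stdNormalCDF (-A) * (1 + r)) ≤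
      54 * A * stdNormalCDF (-A) ^ 2 * Real.exp (-(A * Real.sqrt r / 2)) := by
  have hp := Phi_pos (-A)
  obtain ⟨b, hb, hwb⟩ := w_param (A := A) (by nlinarith) hw
  have hrb : r ≤ 6 * (A * b) := by
    rcases diff_bound (A := A) (by linarith) hb with h | h
    · rw [← hwb] at h
      have : r * stdNormalCDF (-A) ≤ 6 * (A * b) * stdNormalCDF (-A) := by linarith
      exact le_of_mul_le_mul_right this hp
    · linarith
  rw [hwb]
  refine (H_bound2 (by linarith) hb).trans ?_
  have hs1 : Real.sqrt r ≤ 1 := Real.sqrt_le_one.2 hr1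
  have hs0 := Real.sqrt_nonneg r
  have e1 : Real.exp (-2 * A * Real.sqrt (b * (A/2))) ≤ Real.exp (-(A * Real.sqrt r / 2)) := by
    apply Real.exp_le_exp.2
    have : Real.sqrt r / 4 ≤ Real.sqrt (b * (A/2)) := by
      apply Real.le_sqrt_of_sq_le
      rw [div_pow, Real.sq_sqrt hr]; linarith
    nlinarith
  have e2 : Real.exp (-A^2/8) ≤ Real.exp (-(A * Real.sqrt r / 2)) := by
    apply Real.exp_le_exp.2
    nlinarith
  calc _ ≤ 18 * A * stdNormalCDF (-A) ^ 2 * (Real.exp (-(A * Real.sqrt r / 2))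
        + 2 * Real.exp (-(A * Real.sqrt r / 2))) := by gcongr
    _ = _ := by ring

lemma H_far {A w : ℝ} (hA : 16 ≤ A) (h2 : 2 * stdNormalCDF (-A) ≤ w) (hw : w < 1) :
    w * Hfun (stdNormalCDF (-A)) w ≤ 1000 * A^2 * stdNormalCDF (-A) ^ 3 * Real.exp (-A/5) := by
  have hp := Phi_pos (-A)
  obtain ⟨b, hb, hwb⟩ := w_param (A := A) (by linarith) hw
  have hwle : w ≤ 12 * A * stdNormalCDF (-A) * Real.exp (A * b) := by
    rw [hwb]
    refine (Phi_le_exp (by linarith)).trans ?_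
    rw [Real.exp_add]
    have := exp_le_u (A := A) (by linarith)
    calc _ ≤ 2 * ((6 * A * stdNormalCDF (-A)) * Real.exp (A * b)) := by gcongr
      _ = _ := by ring
  have hH0 := Hfun_nonneg (stdNormalCDF (-A)) w
  rcases le_or_gt 1 b with hb1 | hb1
  · have hH := H_bound1 (A := A) (by linarith) hb
    rw [← hwb] at hH
    calc w * Hfun (stdNormalCDF (-A)) w ≤ (12 * A * stdNormalCDF (-A) * Real.exp (A * b)) *
          (18 * A * stdNormalCDF (-A) ^ 2 * Real.exp (-2 * A * b)) := by gcongr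
      _ = 216 * A^2 * stdNormalCDF (-A)^3 * (Real.exp (A * b) * Real.exp (-2*A*b)) := by ring
      _ = 216 * A^2 * stdNormalCDF (-A)^3 * Real.exp (-A*b) := by
        rw [← Real.exp_add]; congr 2; ring
      _ ≤ 1000 * A^2 * stdNormalCDF (-A) ^ 3 * Real.exp (-A/5) := by
        gcongr
        · norm_num
        · nlinarith
  · have hH := H_bound2 (A := A) (by linarith) hb
    rw [← hwb] at hH
    have hAb : 1/6 ≤ A * b := by
      rcases diff_bound (A := A) (by linarith) hb with h | h
      · rw [← hwb] at h
        have : 1 * stdNormalCDF (-A) ≤ 6 * (A * b) * stdNormalCDF (-A) := by linarith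
        have := le_of_mul_le_mul_right this hp
        linarith
      · linarith
    have e1 : A * b + (-2 * A * Real.sqrt (b * (A/2))) ≤ -A/5 := by
      set q := Real.sqrt (b * (A/2)) with hq
      have hq2 : q^2 = b * (A/2) := Real.sq_sqrt (by positivity)
      have hq0 : 0 ≤ q := Real.sqrt_nonneg _
      have hqb : b ≤ q := by
        apply Real.le_sqrt_of_sq_le; nlinarith
      have hq3 : 1/5 ≤ q := by
        apply Real.le_sqrt_of_sq_le; nlinarith
      nlinarith
    have e2 : A * b + (-A^2/8) ≤ -A/5 := by nlinarith
    calc w * Hfun (stdNormalCDF (-A)) w ≤ (12 * A * stdNormalCDF (-A) * Real.exp (A * b)) *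
          (18 * A * stdNormalCDF (-A) ^ 2 * (Real.exp (-2 * A * Real.sqrt (b * (A/2)))
        + 2 * Real.exp (-A^2/8))) := by gcongr
      _ = 216 * A^2 * stdNormalCDF (-A)^3 * (Real.exp (A * b) * Real.exp (-2 * A * Real.sqrt (b * (A/2)))
          + 2 * (Real.exp (A * b) * Real.exp (-A^2/8))) := by ring
      _ ≤ 216 * A^2 * stdNormalCDF (-A)^3 * (Real.exp (-A/5) + 2 * Real.exp (-A/5)) := by
        rw [← Real.exp_add, ← Real.exp_add]
        gcongr
      _ ≤ _ := by
        have : 0 < A^2 * stdNormalCDF (-A)^3 * Real.exp (-A/5) := by positivity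
        linarith


noncomputable def mills (A : ℝ) : ℝ := A * stdNormalCDF (-A) / nphi A

lemma mills_tendsto : Tendsto mills atTop (𝓝 1) := Mills_tendsto

lemma u_tendsto : Tendsto (fun A => stdNormalCDF (-A)) atTop (𝓝 0) :=
  Phi_tendsto_atBot.comp tendsto_neg_atTop_atBot

lemma w_tendsto (y : ℝ) : Tendsto (fun A => stdNormalCDF (-A) * (1 + y / A^2)) atTop (𝓝 0) := by
  have h : Tendsto (fun A : ℝ => 1 + y / A^2) atTop (𝓝 (1 + 0)) :=
    (Tendsto.const_div_atTop (tendsto_pow_atTop (by norm_num)) y).const_add 1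
  have := u_tendsto.mul h
  simpa using this

noncomputable def bfun (y A : ℝ) : ℝ := stdNormalCDFInv (stdNormalCDF (-A) * (1 + y / A^2)) + A

lemma bfun_spec {y A : ℝ} (hy : 0 < y) (hA : 0 < A) (hw : stdNormalCDF (-A) * (1 + y / A^2) < 1) :
    stdNormalCDF (-A + bfun y A) = stdNormalCDF (-A) * (1 + y / A^2) ∧ 0 ≤ bfun y A := by
  have hp := Phi_pos (-A)
  have e : -A + bfun y A = stdNormalCDFInv (stdNormalCDF (-A) * (1 + y / A^2)) := by
    unfold bfun; ring
  have h1 : stdNormalCDF (-A + bfun y A) = stdNormalCDF (-A) * (1 + y / A^2) := by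
    rw [e, Phi_Pinv (by positivity) hw]
  refine ⟨h1, ?_⟩
  have : stdNormalCDF (-A) ≤ stdNormalCDF (-A + bfun y A) := by
    rw [h1]; have : 0 < y / A^2 := by positivity
    nlinarith
  have := Phi_strictMono.le_iff_le.1 this
  linarith

lemma bfun_tendsto {y : ℝ} (hy : 0 < y) : Tendsto (fun A => A^3 * bfun y A) atTop (𝓝 y) := by
  have hup : Tendsto (fun A => y * mills A) atTop (𝓝 y) := by
    simpa using mills_tendsto.const_mul y
  have hlo : Tendsto (fun A => y * mills A * Real.exp (-(y * mills A / A^2))) atTop (𝓝 y) := by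
    have h1 : Tendsto (fun A : ℝ => y * mills A / A^2) atTop (𝓝 0) :=
      hup.div_atTop (tendsto_pow_atTop (by norm_num))
    have h2 := (Real.continuous_exp.tendsto 0).comp (by simpa using h1.neg)
    have := hup.mul h2
    simpa using this
  have hhalf : (0:ℝ) < stdNormalCDF 0 := Phi_pos 0
  have main : ∀ᶠ A in atTop, y * mills A * Real.exp (-(y * mills A / A^2)) ≤ A^3 * bfun y A
      ∧ A^3 * bfun y A ≤ y * mills A := by
    filter_upwards [eventually_gt_atTop (0:ℝ), (w_tendsto y).eventually (gt_mem_nhds hhalf)] with A hA hw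
    obtain ⟨hb1, hb0⟩ := bfun_spec hy hA (hw.trans (Phi_lt_one 0))
    set b := bfun y A with hbdef
    have hbA : b ≤ A := by
      rw [← hb1] at hw
      have := Phi_strictMono.lt_iff_lt.1 hw
      linarith
    have hl := diff_lower hb0 hbA
    have hu := diff_upper hb0 hbA
    rw [hb1] at hl hu
    have hn := nphi_pos A
    have hd : stdNormalCDF (-A) * (1 + y / A^2) - stdNormalCDF (-A) = y * mills A / A^3 * nphi A := by
      unfold mills; field_simp; ring
    rw [hd] at hl hu
    have hl' : b ≤ y * mills A / A^3 := le_of_mul_le_mul_right hl hn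
    have hu' : y * mills A / A^3 ≤ b * Real.exp (A * b) := by
      refine le_of_mul_le_mul_right (a := nphi A) ?_ hn
      linarith
    have h3 : A^3 * b ≤ y * mills A := by
      rw [le_div_iff₀ (by positivity)] at hl'; linarith
    refine ⟨?_, h3⟩
    have h4 : A * b ≤ y * mills A / A^2 := by
      rw [le_div_iff₀ (by positivity)]; linarith
    rw [div_le_iff₀ (by positivity)] at hu'
    rw [Real.exp_neg, ← div_eq_mul_inv, div_le_iff₀ (Real.exp_pos _)]
    calc y * mills A ≤ b * Real.exp (A*b) * A^3 := hu'
      _ = A^3 * b * Real.exp (A * b) := by ring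
      _ ≤ _ := by gcongr
  exact tendsto_of_tendsto_of_tendsto_of_le_of_le' hlo hup (main.mono fun _ h => h.1)
    (main.mono fun _ h => h.2)

lemma Phi_mills {z : ℝ} (hz : 0 < z) : stdNormalCDF (-z) = mills z * nphi z / z := by
  have := nphi_pos z
  unfold mills; field_simp

lemma p_limit {y s : ℝ} (hy : 0 < y) (hs0 : 0 < s) (hs1 : s < 1) :
    Tendsto (fun A => pPair (stdNormalCDF (-A)) (stdNormalCDF (-A) * (1 + y / A^2)) s /
      (A * stdNormalCDF (-A)^2)) atTop (𝓝 (Real.sqrt Real.pi * Real.exp (-2 * Real.sqrt y))) := by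
  set c := stdNormalCDFInv s with hc
  set q : ℝ → ℝ := fun A => Real.sqrt (bfun y A * (c + A)) with hq
  have hAq : Tendsto (fun A => A * q A) atTop (𝓝 (Real.sqrt y)) := by
    have h1 : Tendsto (fun A : ℝ => 1 + c / A) atTop (𝓝 (1 + 0)) :=
      (tendsto_id.const_div_atTop c).const_add 1
    have h2 := (bfun_tendsto hy).mul h1
    rw [add_zero, mul_one] at h2
    have h3 := (Real.continuous_sqrt.tendsto y).comp h2
    refine h3.congr' ?_
    filter_upwards [eventually_gt_atTop (0:ℝ)] with A hA
    have e : A^3 * bfun y A * (1 + c / A) = A^2 * (bfun y A * (c + A)) := by field_simp; ring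
    simp only [Function.comp, hq]
    rw [e, Real.sqrt_mul (by positivity), Real.sqrt_sq hA.le]
  have hq0 : Tendsto q atTop (𝓝 0) := by
    refine (hAq.div_atTop tendsto_id).congr' ?_
    filter_upwards [eventually_gt_atTop (0:ℝ)] with A hA
    simp only [id]; field_simp
  have hqA : Tendsto (fun A => q A / A) atTop (𝓝 0) := hq0.div_atTop tendsto_id
  have hz : Tendsto (fun A => Real.sqrt 2 * (A + q A)) atTop atTop := by
    refine Tendsto.const_mul_atTop (by positivity) ?_
    exact tendsto_atTop_mono (fun A => le_add_of_nonneg_right (Real.sqrt_nonneg _)) tendsto_id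
  have hlim : Tendsto (fun A => mills (Real.sqrt 2 * (A + q A)) / mills A ^ 2 *
      (Real.sqrt Real.pi * Real.exp (-2 * (A * q A) - (q A)^2)) / (1 + q A / A)) atTop
      (𝓝 (1 / 1^2 * (Real.sqrt Real.pi * Real.exp (-2 * Real.sqrt y - 0^2)) / (1 + 0))) := by
    have h1 := (mills_tendsto.comp hz).div (mills_tendsto.pow 2) (by norm_num)
    have h2 := (((Real.continuous_exp.tendsto _).comp ((hAq.const_mul (-2)).sub (hq0.pow 2)))).const_mul
      (Real.sqrt Real.pi)
    have h3 := hqA.const_add 1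
    exact (h1.mul h2).div h3 (by norm_num)
  have e0 : (1 / 1^2 * (Real.sqrt Real.pi * Real.exp (-2 * Real.sqrt y - 0^2)) / (1 + 0)) =
      Real.sqrt Real.pi * Real.exp (-2 * Real.sqrt y) := by simp
  rw [e0] at hlim
  refine hlim.congr' ?_
  filter_upwards [eventually_gt_atTop (0:ℝ), (w_tendsto y).eventually (gt_mem_nhds one_pos)] with A hA hw
  obtain ⟨hb1, hb0⟩ := bfun_spec hy hA hw
  have hsA : s = stdNormalCDF (-A + (c + A)) := by
    have : -A + (c + A) = c := by ring
    rw [this, hc, Phi_Pinv hs0 hs1]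
  have hqA0 : 0 ≤ q A := Real.sqrt_nonneg _
  have hzp : 0 < Real.sqrt 2 * (A + q A) := by positivity
  have e1 : pPair (stdNormalCDF (-A)) (stdNormalCDF (-A) * (1 + y / A^2)) s =
      stdNormalCDF (-(Real.sqrt 2 * (A + q A))) := by
    rw [← hb1]
    conv_lhs => rw [hsA]
    rw [pPair_Phi]
    congr 1
    simp only [hq]; ring
  rw [e1, Phi_mills hzp, Phi_mills hA]
  have hn := nphi_pos A
  have hs2 : 0 < Real.sqrt (2 * Real.pi) := by positivity
  have e2 : nphi (Real.sqrt 2 * (A + q A)) = nphi A ^2 * (Real.sqrt 2 * Real.sqrt Real.pi) *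
      Real.exp (-2 * (A * q A) - (q A)^2) := by
    unfold nphi
    have e3 : Real.exp (-A^2/2)^2 = Real.exp (-A^2) := by
      rw [← Real.exp_nat_mul]; congr 1; push_cast; ring
    rw [← Real.sqrt_mul (by norm_num), div_pow, e3]
    have e4 : Real.exp (-(Real.sqrt 2 * (A + q A))^2/2) =
        Real.exp (-A^2) * Real.exp (-2 * (A * q A) - (q A)^2) := by
      rw [← Real.exp_add, mul_pow, Real.sq_sqrt (by norm_num)]; congr 1; ring
    rw [e4]
    field_simp
  rw [e2]
  have hm : 0 < mills A := by
    unfold mills; have := Phi_pos (-A); positivity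
  have h22 : 0 < Real.sqrt 2 := by positivity
  have hAq' : 0 < A + q A := by positivity
  field_simp

lemma p_le {A b s : ℝ} (hA : 1 ≤ A) (hs : s ∈ Ioo (stdNormalCDF (-A + b)) 1) :
    pPair (stdNormalCDF (-A)) (stdNormalCDF (-A + b)) s ≤ 18 * A * stdNormalCDF (-A) ^ 2 := by
  have hp := Phi_pos (-A)
  obtain ⟨c, hc, rfl⟩ := s_param hs
  rw [pPair_Phi]
  refine (p_bound hA (Real.sqrt_nonneg _)).trans ?_
  have : Real.exp (-2 * A * Real.sqrt (b * c)) ≤ 1 := by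
    apply Real.exp_le_one_iff.2
    have := Real.sqrt_nonneg (b*c); nlinarith
  exact mul_le_of_le_one_right (by positivity) this

lemma H_limit {y : ℝ} (hy : 0 < y) :
    Tendsto (fun A => Hfun (stdNormalCDF (-A)) (stdNormalCDF (-A) * (1 + y / A^2)) /
      (A * stdNormalCDF (-A)^2)) atTop (𝓝 (Real.sqrt Real.pi * Real.exp (-2 * Real.sqrt y))) := by
  set w : ℝ → ℝ := fun A => stdNormalCDF (-A) * (1 + y / A^2) with hwdef
  set F : ℝ → ℝ → ℝ := fun A s => (Ioi (w A)).indicator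
    (fun s => pPair (stdNormalCDF (-A)) (w A) s / (A * stdNormalCDF (-A)^2)) s with hF
  have hD : Tendsto (fun A => ∫ s in Ioo (0:ℝ) 1, F A s) atTop
      (𝓝 (∫ s in Ioo (0:ℝ) 1, Real.sqrt Real.pi * Real.exp (-2 * Real.sqrt y))) := by
    refine tendsto_integral_filter_of_dominated_convergence (fun _ => 18) ?_ ?_ (by simp) ?_
    · refine Eventually.of_forall fun A => ?_
      exact (((pPair_measurable_s _ _).div_const _).indicator measurableSet_Ioi).aestronglyMeasurable
    · filter_upwards [eventually_ge_atTop (1:ℝ), (w_tendsto y).eventually (gt_mem_nhds one_pos)] with A hA hw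
      refine (ae_restrict_iff' measurableSet_Ioo).2 (Eventually.of_forall fun s hs => ?_)
      obtain ⟨hb1, hb0⟩ := bfun_spec hy (by linarith) hw
      have hp := Phi_pos (-A)
      by_cases hsw : s ∈ Ioi (w A)
      · simp only [hF]
        rw [indicator_of_mem hsw, Real.norm_of_nonneg
          (div_nonneg (pPair_pos _ _ _).le (by positivity)), div_le_iff₀ (by positivity)]
        have := p_le (A := A) (b := bfun y A) (s := s) hA (by rw [hb1]; exact ⟨hsw, hs.2⟩)
        rw [hb1] at this
        calc _ ≤ _ := this
          _ = _ := by ring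
      · simp only [hF]
        rw [indicator_of_notMem hsw]; simp
    · refine (ae_restrict_iff' measurableSet_Ioo).2 (Eventually.of_forall fun s hs => ?_)
      refine (p_limit hy hs.1 hs.2).congr' ?_
      filter_upwards [(w_tendsto y).eventually (gt_mem_nhds hs.1)] with A hA
      simp only [hF]
      rw [indicator_of_mem (by exact hA)]
  have e1 : ∫ s in Ioo (0:ℝ) 1, Real.sqrt Real.pi * Real.exp (-2 * Real.sqrt y)
      = Real.sqrt Real.pi * Real.exp (-2 * Real.sqrt y) := by simp
  rw [e1] at hD
  refine hD.congr' ?_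
  filter_upwards [eventually_gt_atTop (0:ℝ)] with A hA
  have hp := Phi_pos (-A)
  have hw0 : 0 < w A := by simp only [hwdef]; positivity
  simp only [hF]
  rw [setIntegral_indicator measurableSet_Ioi]
  have : Ioo (0:ℝ) 1 ∩ Ioi (w A) = Ioo (w A) 1 := by
    ext s; simp only [mem_inter_iff, mem_Ioo, mem_Ioi]
    constructor
    · rintro ⟨⟨_, h⟩, h2⟩; exact ⟨h2, h⟩
    · rintro ⟨h, h2⟩; exact ⟨⟨hw0.trans h, h2⟩, h⟩
  rw [this, integral_div]; rfl


noncomputable def Dk (k : ℕ) (u w : ℝ) : ℝ := (1 - u)^(k+1) - (1 - w)^(k+1)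

lemma pow_diff_bounds (k : ℕ) {a b : ℝ} (hb : 0 ≤ b) (hab : b ≤ a) :
    ((k:ℝ)+1) * (a - b) * b^k ≤ a^(k+1) - b^(k+1) ∧
    a^(k+1) - b^(k+1) ≤ ((k:ℝ)+1) * (a - b) * a^k := by
  have ha : 0 ≤ a := hb.trans hab
  induction k with
  | zero => simp
  | succ k ih =>
    obtain ⟨h1, h2⟩ := ih
    have e : a^(k+1+1) - b^(k+1+1) = a * (a^(k+1) - b^(k+1)) + (a - b) * b^(k+1) := by ring
    have hpow : b^(k+1) ≤ a^(k+1) := by gcongr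
    have hbk : 0 ≤ b^k := by positivity
    have hak : 0 ≤ a^k := by positivity
    have hd : 0 ≤ a - b := by linarith
    rw [e]
    push_cast
    constructor
    · have h3 : b * (((k:ℝ)+1) * (a - b) * b^k) ≤ a * (a^(k+1) - b^(k+1)) := by
        refine mul_le_mul hab h1 (by positivity) ha
      calc _ = b * (((k:ℝ)+1) * (a - b) * b^k) + (a-b) * b^(k+1) := by ring
        _ ≤ _ := by linarith
    · have h3 : a * (a^(k+1) - b^(k+1)) ≤ a * (((k:ℝ)+1) * (a - b) * a^k) := by gcongr
      have h4 : (a - b) * b^(k+1) ≤ (a - b) * a^(k+1) := by gcongr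
      calc _ ≤ a * (((k:ℝ)+1) * (a - b) * a^k) + (a-b) * a^(k+1) := by linarith
        _ = _ := by ring

lemma Dk_bounds (k : ℕ) {u w : ℝ} (huw : u ≤ w) (hw : w ≤ 1) :
    ((k:ℝ)+1) * (w - u) * (1-w)^k ≤ Dk k u w ∧ Dk k u w ≤ ((k:ℝ)+1) * (w - u) * (1-u)^k := by
  have := pow_diff_bounds k (a := 1 - u) (b := 1 - w) (by linarith) (by linarith)
  have e : 1 - u - (1 - w) = w - u := by ring
  rw [e] at this
  exact this

lemma Dk_nonneg (k : ℕ) {u w : ℝ} (huw : u ≤ w) (hw : w ≤ 1) : 0 ≤ Dk k u w := by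
  refine le_trans ?_ (Dk_bounds k huw hw).1
  have : 0 ≤ w - u := by linarith
  have : 0 ≤ 1 - w := by linarith
  positivity

lemma Dk_le (k : ℕ) {u w : ℝ} (hu : 0 ≤ u) (huw : u ≤ w) (hw : w ≤ 1) : Dk k u w ≤ (1-u)^k := by
  unfold Dk
  have h1 : 0 ≤ (1-w)^(k+1) := by have : 0 ≤ 1 - w := by linarith
                                  positivity
  have h2 : (1-u)^(k+1) ≤ (1-u)^k := pow_le_pow_of_le_one (by linarith) (by linarith) (by omega)
  linarith

lemma DH_measurable (k : ℕ) : Measurable (fun q : ℝ × ℝ => Dk k q.1 q.2 * Hfun q.1 q.2) := by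
  refine Measurable.mul ?_ Hfun_measurable
  unfold Dk; fun_prop

lemma DH_integrableOn (k : ℕ) {u a : ℝ} {S : Set ℝ} (hu : 0 < u) (hua : u ≤ a) (hS : S ⊆ Icc a 1)
    (hSm : MeasurableSet S) :
    IntegrableOn (fun w => Dk k u w * Hfun u w) S := by
  have hvol : volume S ≠ ⊤ := ne_top_of_le_ne_top (by simp) (measure_mono hS)
  refine Measure.integrableOn_of_bounded (M := 1) hvol ?_ ?_
  · exact ((DH_measurable k).comp (measurable_const (a := u) |>.prodMk measurable_id)).aestronglyMeasurable
  · refine (ae_restrict_iff' hSm).2 (Eventually.of_forall fun w hw => ?_)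
    have hw' := hS hw
    have h1 := Dk_nonneg k (hua.trans hw'.1) hw'.2
    have h2 := Hfun_nonneg u w
    have h3 := Dk_le k hu.le (hua.trans hw'.1) hw'.2
    have h4 := Hfun_le_one (u := u) (w := w) (by linarith [hw'.1]) hw'.2
    have h5 : (1-u)^k ≤ 1 := pow_le_one₀ (by linarith [hw'.1, hw'.2]) (by linarith)
    rw [Real.norm_of_nonneg (by positivity)]
    exact mul_le_one₀ (h3.trans h5) h2 h4

noncomputable def Ik (k : ℕ) (u : ℝ) : ℝ := ∫ w in Ioo u 1, Dk k u w * Hfun u w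

lemma Ik_split (k : ℕ) {u : ℝ} (hu : 0 < u) (hu2 : 2 * u < 1) :
    Ik k u = (∫ w in Ioc u (2*u), Dk k u w * Hfun u w) + ∫ w in Ioo (2*u) 1, Dk k u w * Hfun u w := by
  unfold Ik
  rw [← Ioc_union_Ioo_eq_Ioo (b := 2*u) (by linarith) hu2]
  refine setIntegral_union ?_ measurableSet_Ioo ?_ ?_
  · rw [Set.disjoint_left]; intro w h1 h2; exact absurd h1.2 (not_le.2 h2.1)
  · exact DH_integrableOn k hu le_rfl (fun w hw => ⟨hw.1.le, hw.2.trans hu2.le⟩) measurableSet_Ioc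
  · exact DH_integrableOn k hu (a := 2*u) (by linarith) (fun w hw => ⟨hw.1.le, hw.2.le⟩) measurableSet_Ioo

lemma Ik_nonneg (k : ℕ) (u : ℝ) : 0 ≤ Ik k u :=
  setIntegral_nonneg measurableSet_Ioo fun w hw =>
    mul_nonneg (Dk_nonneg k hw.1.le hw.2.le) (Hfun_nonneg u w)

lemma Ik_le (k : ℕ) {u : ℝ} (hu : 0 < u) (hu1 : u < 1) : Ik k u ≤ (1-u)^k := by
  have : Ik k u ≤ ∫ w in Ioo u 1, (1-u)^k := by
    refine setIntegral_mono_on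
      (DH_integrableOn k hu le_rfl (fun w hw => ⟨hw.1.le, hw.2.le⟩) measurableSet_Ioo) (by simp)
      measurableSet_Ioo fun w hw => ?_
    have h2 := Hfun_nonneg u w
    have h3 := Dk_le k hu.le hw.1.le hw.2.le
    have h4 := Hfun_le_one (u := u) (w := w) (by linarith [hw.1]) hw.2.le
    have h6 : 0 ≤ (1-u)^k := by have : 0 ≤ 1 - u := by linarith
                                positivity
    calc _ ≤ (1-u)^k * 1 := by gcongr
      _ = _ := by ring
  refine this.trans ?_
  have h6 : 0 ≤ (1-u)^k := by have : 0 ≤ 1 - u := by linarith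
                              positivity
  simp [hu1.le]
  nlinarith

lemma Ik_measurable (k : ℕ) : Measurable (Ik k) := by
  have h : Ik k = fun u => ∫ w,
      ({z : ℝ × ℝ | z.1 < z.2 ∧ z.2 < 1}.indicator
        (fun z : ℝ × ℝ => Dk k z.1 z.2 * Hfun z.1 z.2)) (u, w) := by
    funext q
    rw [Ik, ← integral_indicator measurableSet_Ioo]
    rfl
  rw [h]
  have hm : MeasurableSet {z : ℝ × ℝ | z.1 < z.2 ∧ z.2 < 1} := 
    (measurableSet_lt (f := fun z : ℝ × ℝ => z.1) (g := fun z => z.2) (by fun_prop)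
      (by fun_prop)).inter (measurableSet_lt (f := fun z : ℝ × ℝ => z.2) (g := fun _ => 1)
      (by fun_prop) (by fun_prop))
  have hs := ((DH_measurable k).indicator hm).stronglyMeasurable
  exact (StronglyMeasurable.integral_prod_right (ν := (volume : Measure ℝ))
    (f := fun (u : ℝ) (w : ℝ) =>
      ({z : ℝ × ℝ | z.1 < z.2 ∧ z.2 < 1}.indicator
        (fun z : ℝ × ℝ => Dk k z.1 z.2 * Hfun z.1 z.2)) (u, w)) hs).measurable

lemma u_half {A : ℝ} (hA : 0 < A) : 2 * stdNormalCDF (-A) < 1 := by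
  have h1 := Phi_add_neg 0
  have h2 : stdNormalCDF (-A) < stdNormalCDF 0 := Phi_strictMono (by linarith)
  rw [neg_zero] at h1; linarith

noncomputable def Fk (k : ℕ) (A y : ℝ) : ℝ :=
  (Ioc 0 (A^2)).indicator (fun y => A^2 * Dk k (stdNormalCDF (-A)) (stdNormalCDF (-A) * (1 + y/A^2)) *
    (Hfun (stdNormalCDF (-A)) (stdNormalCDF (-A) * (1 + y/A^2)) / (A * stdNormalCDF (-A)^2))) y

lemma near_id (k : ℕ) {A : ℝ} (hA : 0 < A) :
    ∫ w in Ioc (stdNormalCDF (-A)) (2 * stdNormalCDF (-A)),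
      Dk k (stdNormalCDF (-A)) w * Hfun (stdNormalCDF (-A)) w =
    stdNormalCDF (-A)^3 / A^3 * ∫ y in Ioi 0, Fk k A y := by
  have hp := Phi_pos (-A)
  set u := stdNormalCDF (-A) with hu
  have h1 : ∫ y in Ioi 0, Fk k A y = ∫ y in (0:ℝ)..A^2, A^2 * Dk k u (u * (1 + y/A^2)) *
    (Hfun u (u * (1 + y/A^2)) / (A * u^2)) := by
    unfold Fk
    rw [setIntegral_indicator measurableSet_Ioc, intervalIntegral.integral_of_le (by positivity)]
    congr 2
    ext y; simp only [mem_inter_iff, mem_Ioi, mem_Ioc]; tauto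
  have h2 : ∀ y, A^2 * Dk k u (u * (1 + y/A^2)) * (Hfun u (u * (1 + y/A^2)) / (A * u^2)) =
      (A / u^2) * (fun w => Dk k u w * Hfun u w) (u + (u/A^2) * y) := by
    intro y
    have e : u + (u/A^2) * y = u * (1 + y/A^2) := by ring
    simp only [e]
    field_simp
  rw [h1]
  simp_rw [h2]
  rw [intervalIntegral.integral_const_mul,
    intervalIntegral.integral_comp_add_mul (fun w => Dk k u w * Hfun u w) (by positivity) u]
  have e1 : u + u / A^2 * 0 = u := by ring
  have e2 : u + u / A^2 * A^2 = 2 * u := by field_simp; ring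
  rw [e1, e2, intervalIntegral.integral_of_le (by linarith)]
  simp only [smul_eq_mul]
  field_simp

noncomputable def gdom (y : ℝ) : ℝ := y * Real.exp (-(Real.sqrt y / 2))

lemma gdom_integrable : IntegrableOn gdom (Ioi 0) := by
  have := integrableOn_rpow_mul_exp_neg_mul_rpow (p := 1/2) (s := 1) (b := 1/2) (by norm_num) (by norm_num)
    (by norm_num)
  refine this.congr_fun (fun y hy => ?_) measurableSet_Ioi
  simp only [gdom, Real.rpow_one, Real.sqrt_eq_rpow]
  congr 2; ring

lemma Fk_measurable (k : ℕ) (A : ℝ) : Measurable (Fk k A) := by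
  unfold Fk
  refine Measurable.indicator ?_ measurableSet_Ioc
  refine Measurable.mul ?_ (Measurable.div_const ?_ _)
  · unfold Dk; fun_prop
  · exact Hfun_measurable.comp (measurable_const.prodMk (by fun_prop))

lemma Fk_bound (k : ℕ) {A y : ℝ} (hA : 4 ≤ A) (hy : 0 < y) :
    0 ≤ Fk k A y ∧ Fk k A y ≤ 54 * (((k:ℝ)+1) * stdNormalCDF (-A) * (1 - stdNormalCDF (-A))^k) * gdom y := by
  have hp := Phi_pos (-A)
  have h1u : 0 < 1 - stdNormalCDF (-A) := by linarith [Phi_lt_one (-A)]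
  have hg : 0 ≤ gdom y := by unfold gdom; positivity
  have hhalf := u_half (A := A) (by linarith)
  unfold Fk
  set u := stdNormalCDF (-A) with hu
  by_cases hyA : y ∈ Ioc 0 (A^2)
  · rw [indicator_of_mem hyA]
    have hr1 : y / A^2 ≤ 1 := (div_le_one (by positivity)).2 hyA.2
    have hr0 : 0 < y / A^2 := by positivity
    have hw1 : u * (1 + y/A^2) < 1 := by nlinarith
    have huw : u ≤ u * (1 + y/A^2) := by nlinarith
    have hD0 := Dk_nonneg k huw hw1.le
    have hD1 := (Dk_bounds k huw hw1.le).2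
    have hH0 := Hfun_nonneg u (u * (1 + y/A^2))
    have hH1 := H_near hA hr0.le hr1 hw1
    refine ⟨by positivity, ?_⟩
    have e1 : A * Real.sqrt (y/A^2) = Real.sqrt y := by
      rw [Real.sqrt_div hy.le, Real.sqrt_sq (by linarith)]; field_simp
    rw [e1] at hH1
    have hH2 : Hfun u (u * (1 + y/A^2)) / (A * u^2) ≤ 54 * Real.exp (-(Real.sqrt y / 2)) := by
      rw [div_le_iff₀ (by positivity)]
      calc _ ≤ _ := hH1
        _ = _ := by ring
    have hD2 : A^2 * Dk k u (u * (1 + y/A^2)) ≤ ((k:ℝ)+1) * u * (1-u)^k * y := by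
      calc _ ≤ A^2 * (((k:ℝ)+1) * (u * (1 + y/A^2) - u) * (1-u)^k) := by gcongr
        _ = _ := by field_simp; ring
    calc _ ≤ (((k:ℝ)+1) * u * (1-u)^k * y) * (54 * Real.exp (-(Real.sqrt y / 2))) := by gcongr
      _ = _ := by unfold gdom; ring
  · rw [indicator_of_notMem hyA]
    exact ⟨le_rfl, by positivity⟩

lemma near_bound (k : ℕ) {A : ℝ} (hA : 4 ≤ A) :
    ∫ w in Ioc (stdNormalCDF (-A)) (2 * stdNormalCDF (-A)),
      Dk k (stdNormalCDF (-A)) w * Hfun (stdNormalCDF (-A)) w ≤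
    54 * (∫ y in Ioi 0, gdom y) * (((k:ℝ)+1) * stdNormalCDF (-A)^4 * (1 - stdNormalCDF (-A))^k) / A^3 := by
  rw [near_id k (by linarith)]
  have hp := Phi_pos (-A)
  set u := stdNormalCDF (-A) with hu
  have hle : ∫ y in Ioi 0, Fk k A y ≤ ∫ y in Ioi 0, 54 * (((k:ℝ)+1) * u * (1 - u)^k) * gdom y := by
    refine setIntegral_mono_on ?_ (gdom_integrable.const_mul _) measurableSet_Ioi
      (fun y hy => (Fk_bound k hA hy).2)
    refine Integrable.mono' (gdom_integrable.const_mul (54 * (((k:ℝ)+1) * u * (1 - u)^k)))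
      (Fk_measurable k A).aestronglyMeasurable ?_
    refine (ae_restrict_iff' measurableSet_Ioi).2 (Eventually.of_forall fun y hy => ?_)
    have := Fk_bound k hA hy
    rw [Real.norm_of_nonneg this.1]
    exact this.2
  rw [integral_const_mul] at hle
  calc _ ≤ u^3/A^3 * (54 * (((k:ℝ)+1) * u * (1 - u)^k) * ∫ y in Ioi 0, gdom y) := by gcongr
    _ = _ := by ring

lemma log_inv_le {A : ℝ} (hA : 16 ≤ A) : - Real.log (stdNormalCDF (-A)) ≤ A^2 := by
  have hp := Phi_pos (-A)
  have h := exp_le_u (A := A) (by linarith)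
  have h2 := Real.log_le_log (Real.exp_pos _) h
  rw [Real.log_exp, Real.log_mul (by positivity) hp.ne'] at h2
  have h3 := Real.log_le_sub_one_of_pos (x := 6 * A) (by positivity)
  nlinarith

lemma far_bound (k : ℕ) {A : ℝ} (hA : 16 ≤ A) :
    ∫ w in Ioo (2 * stdNormalCDF (-A)) 1,
      Dk k (stdNormalCDF (-A)) w * Hfun (stdNormalCDF (-A)) w ≤
    (1000 * 5^8 * 40320) * (stdNormalCDF (-A)^3 * (1 - stdNormalCDF (-A))^k) / A^4 := by
  have hp := Phi_pos (-A)
  have h1u : 0 < 1 - stdNormalCDF (-A) := by linarith [Phi_lt_one (-A)]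
  have hhalf := u_half (A := A) (by linarith)
  have hlog := log_inv_le hA
  have hfar := fun w => H_far (A := A) (w := w) hA
  set u := stdNormalCDF (-A) with hu
  set M := 1000 * A^2 * u^3 * Real.exp (-A/5) with hM
  have hM0 : 0 < M := by positivity
  have h0 : ∀ w ∈ uIcc (2*u) 1, w ≠ 0 := by
    intro w hw; rw [uIcc_of_le hhalf.le] at hw; linarith [hw.1]
  have hInteg : IntegrableOn (fun w : ℝ => (1-u)^k * M * (1/w)) (Ioo (2*u) 1) := by
    have : IntervalIntegrable (fun w : ℝ => (1-u)^k * M * (1/w)) volume (2*u) 1 := by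
      refine ContinuousOn.intervalIntegrable ?_
      refine continuousOn_const.mul (continuousOn_const.div continuousOn_id h0)
    rw [intervalIntegrable_iff_integrableOn_Ioo_of_le hhalf.le] at this
    exact this
  have hle : ∫ w in Ioo (2 * u) 1, Dk k u w * Hfun u w ≤ ∫ w in Ioo (2 * u) 1, (1-u)^k * M * (1/w) := by
    refine setIntegral_mono_on (DH_integrableOn k hp (a := 2*u) (by linarith)
      (fun w hw => ⟨hw.1.le, hw.2.le⟩) measurableSet_Ioo) hInteg measurableSet_Ioo fun w hw => ?_
    have hw0 : 0 < w := by linarith [hw.1]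
    have h1 := hfar w hw.1.le hw.2
    have h2 : Hfun u w ≤ M * (1/w) := by
      rw [mul_one_div, le_div_iff₀ hw0]; linarith
    have h3 := Dk_le k hp.le (w := w) (by linarith [hw.1]) hw.2.le
    have h4 := Hfun_nonneg u w
    calc _ ≤ (1-u)^k * (M * (1/w)) := by gcongr
      _ = _ := by ring
  refine hle.trans ?_
  have e : ∫ w in Ioo (2 * u) 1, (1-u)^k * M * (1/w) = (1-u)^k * M * Real.log (1 / (2*u)) := by
    rw [← integral_one_div (by rw [uIcc_of_le hhalf.le]; intro h; linarith [h.1]),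
      ← intervalIntegral.integral_const_mul, intervalIntegral.integral_of_le hhalf.le,
      integral_Ioc_eq_integral_Ioo]
  rw [e]
  have hl : Real.log (1/(2*u)) ≤ A^2 := by
    rw [one_div, Real.log_inv, Real.log_mul (by norm_num) hp.ne']
    have := Real.log_nonneg (x := 2) (by norm_num)
    linarith
  have hexp : A^8 * Real.exp (-A/5) ≤ 5^8 * 40320 := by
    have h := Real.pow_div_factorial_le_exp (x := A/5) (by positivity) 8
    have e8 : ((Nat.factorial 8 : ℕ) : ℝ) = 40320 := by norm_num [Nat.factorial]
    rw [e8] at h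
    have : Real.exp (-A/5) = (Real.exp (A/5))⁻¹ := by rw [← Real.exp_neg]; congr 1; ring
    rw [this, ← div_eq_mul_inv, div_le_iff₀ (Real.exp_pos _)]
    rw [div_pow, div_div, div_le_iff₀ (by positivity)] at h
    linarith
  rw [le_div_iff₀ (by positivity)]
  calc (1-u)^k * M * Real.log (1/(2*u)) * A^4 ≤ (1-u)^k * M * A^2 * A^4 := by gcongr
    _ = 1000 * (u^3 * (1-u)^k) * (A^8 * Real.exp (-A/5)) := by rw [hM]; ring
    _ ≤ 1000 * (u^3 * (1-u)^k) * (5^8 * 40320) := by gcongr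
    _ = _ := by ring


lemma one_sub_pow_limit {v : ℕ → ℝ} {x : ℝ} (h : Tendsto (fun k : ℕ => (k:ℝ) * v k) atTop (𝓝 x)) :
    Tendsto (fun k : ℕ => (1 - v k)^k) atTop (𝓝 (Real.exp (-x))) := by
  have := Real.tendsto_one_add_pow_exp_of_tendsto (g := fun k => - v k) (t := -x)
    (by simpa using h.neg)
  simpa [sub_eq_add_neg] using this

/-- The boundary level attached to `x/(k+4)`. -/
noncomputable def Ax (x : ℝ) (k : ℕ) : ℝ := - stdNormalCDFInv (x / ((k:ℝ) + 4))

lemma xdiv_tendsto (x : ℝ) : Tendsto (fun k : ℕ => x / ((k:ℝ)+4)) atTop (𝓝 0) :=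
  Tendsto.const_div_atTop (tendsto_atTop_add_const_right _ _ tendsto_natCast_atTop_atTop) x

lemma Ax_spec {x : ℝ} (hx : 0 < x) : ∀ᶠ k : ℕ in atTop, stdNormalCDF (-(Ax x k)) = x / ((k:ℝ)+4) := by
  filter_upwards [(xdiv_tendsto x).eventually (gt_mem_nhds one_pos)] with k hk
  unfold Ax
  rw [neg_neg, Phi_Pinv (by positivity) hk]

lemma Ax_tendsto {x : ℝ} (hx : 0 < x) : Tendsto (Ax x) atTop atTop := by
  rw [tendsto_atTop]
  intro M
  filter_upwards [Ax_spec hx, (xdiv_tendsto x).eventually (gt_mem_nhds (Phi_pos (-M)))] with k hk hk2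
  rw [← hk] at hk2
  have := Phi_strictMono.lt_iff_lt.1 hk2
  linarith

lemma kx_tendsto (x : ℝ) : Tendsto (fun k : ℕ => (k:ℝ) * (x / ((k:ℝ)+4))) atTop (𝓝 x) := by
  have := (tendsto_natCast_div_add_atTop (4:ℝ)).mul_const x
  rw [one_mul] at this
  refine this.congr fun k => by ring

lemma k1x_tendsto (x : ℝ) : Tendsto (fun k : ℕ => ((k:ℝ)+1) * (x / ((k:ℝ)+4))) atTop (𝓝 x) := by
  have := (kx_tendsto x).add (xdiv_tendsto x)
  rw [add_zero] at this
  refine this.congr fun k => by ring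

lemma D_limit {x y : ℝ} (hx : 0 < x) (hy : 0 < y) :
    Tendsto (fun k : ℕ => (Ax x k)^2 * Dk k (stdNormalCDF (-(Ax x k)))
      (stdNormalCDF (-(Ax x k)) * (1 + y/(Ax x k)^2))) atTop (𝓝 (x * y * Real.exp (-x))) := by
  have hA := Ax_tendsto hx
  have hA2 : Tendsto (fun k => 1 + y / (Ax x k)^2) atTop (𝓝 1) := by
    have := ((tendsto_pow_atTop (n := 2) (by norm_num)).comp hA).const_div_atTop y
    simpa using this.const_add 1
  have hup : Tendsto (fun k : ℕ => ((k:ℝ)+1) * (x / ((k:ℝ)+4)) * y * (1 - x / ((k:ℝ)+4))^k) atTop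
      (𝓝 (x * y * Real.exp (-x))) :=
    ((k1x_tendsto x).mul_const y).mul (one_sub_pow_limit (kx_tendsto x))
  have hlo : Tendsto (fun k : ℕ => ((k:ℝ)+1) * (x / ((k:ℝ)+4)) * y *
      (1 - x / ((k:ℝ)+4) * (1 + y / (Ax x k)^2))^k) atTop (𝓝 (x * y * Real.exp (-x))) := by
    refine ((k1x_tendsto x).mul_const y).mul (one_sub_pow_limit ?_)
    have := (kx_tendsto x).mul hA2
    rw [mul_one] at this
    exact this.congr fun k => by ring
  have main : ∀ᶠ k : ℕ in atTop, ((k:ℝ)+1) * (x / ((k:ℝ)+4)) * y *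
      (1 - x / ((k:ℝ)+4) * (1 + y / (Ax x k)^2))^k ≤ (Ax x k)^2 * Dk k (stdNormalCDF (-(Ax x k)))
      (stdNormalCDF (-(Ax x k)) * (1 + y/(Ax x k)^2)) ∧
      (Ax x k)^2 * Dk k (stdNormalCDF (-(Ax x k)))
      (stdNormalCDF (-(Ax x k)) * (1 + y/(Ax x k)^2)) ≤
       ((k:ℝ)+1) * (x / ((k:ℝ)+4)) * y * (1 - x / ((k:ℝ)+4))^k := by
    filter_upwards [Ax_spec hx, hA.eventually ((w_tendsto y).eventually (gt_mem_nhds one_pos)),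
      hA.eventually (eventually_gt_atTop 0)] with k h1 h2 h3
    rw [h1] at h2 ⊢
    set u := x / ((k:ℝ)+4) with hu
    set A := Ax x k
    have hu0 : 0 < u := by positivity
    have hr : 0 < y / A^2 := by positivity
    have hb := Dk_bounds k (u := u) (w := u * (1 + y/A^2)) (by nlinarith) h2.le
    constructor
    · calc _ = A^2 * (((k:ℝ)+1) * (u * (1 + y/A^2) - u) * (1 - u * (1 + y/A^2))^k) := by field_simp; ring
        _ ≤ _ := by gcongr; exact hb.1
    · calc _ ≤ A^2 * (((k:ℝ)+1) * (u * (1 + y/A^2) - u) * (1 - u)^k) := by gcongr; exact hb.2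
        _ = _ := by field_simp; ring
  exact tendsto_of_tendsto_of_tendsto_of_le_of_le' hlo hup (main.mono fun _ h => h.1)
    (main.mono fun _ h => h.2)

lemma near_limit {x : ℝ} (hx : 0 < x) :
    Tendsto (fun k : ℕ => ∫ y in Ioi 0, Fk k (Ax x k) y) atTop
      (𝓝 (∫ y in Ioi 0, x * y * Real.exp (-x) * (Real.sqrt Real.pi * Real.exp (-2 * Real.sqrt y)))) := by
  have hA := Ax_tendsto hx
  refine tendsto_integral_filter_of_dominated_convergence (fun y => 54 * x * gdom y) ?_ ?_
    (gdom_integrable.const_mul _) ?_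
  · exact Eventually.of_forall fun k => (Fk_measurable k _).aestronglyMeasurable
  · filter_upwards [Ax_spec hx, hA.eventually (eventually_ge_atTop 4)] with k h1 h2
    refine (ae_restrict_iff' measurableSet_Ioi).2 (Eventually.of_forall fun y hy => ?_)
    have hb := Fk_bound k h2 hy
    rw [Real.norm_of_nonneg hb.1]
    refine hb.2.trans ?_
    have hg : 0 ≤ gdom y := by
      unfold gdom; have : 0 < y := hy
      positivity
    have hp := Phi_pos (-(Ax x k))
    have hlt := Phi_lt_one (-(Ax x k))
    have h3 : ((k:ℝ)+1) * stdNormalCDF (-(Ax x k)) * (1 - stdNormalCDF (-(Ax x k)))^k ≤ x := by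
      have h4 : (1 - stdNormalCDF (-(Ax x k)))^k ≤ 1 := pow_le_one₀ (by linarith) (by linarith)
      have h5 : ((k:ℝ)+1) * stdNormalCDF (-(Ax x k)) ≤ x := by
        rw [h1, mul_div_assoc', div_le_iff₀ (by positivity)]; nlinarith
      calc _ ≤ ((k:ℝ)+1) * stdNormalCDF (-(Ax x k)) * 1 := by gcongr
        _ ≤ x := by linarith
    gcongr
  · refine (ae_restrict_iff' measurableSet_Ioi).2 (Eventually.of_forall fun y hy => ?_)
    have hy : 0 < y := hy
    have := (D_limit hx hy).mul ((H_limit hy).comp hA)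
    refine this.congr' ?_
    have h2 : ∀ᶠ k in atTop, y ≤ (Ax x k)^2 :=
      ((tendsto_pow_atTop (n := 2) (by norm_num)).comp hA).eventually (eventually_ge_atTop y)
    filter_upwards [h2] with k hk
    unfold Fk
    rw [indicator_of_mem (show y ∈ Ioc 0 ((Ax x k)^2) from ⟨hy, hk⟩)]
    rfl

lemma near_integral (x : ℝ) :
    ∫ y in Ioi 0, x * y * Real.exp (-x) * (Real.sqrt Real.pi * Real.exp (-2 * Real.sqrt y)) =
      3/4 * Real.sqrt Real.pi * (x * Real.exp (-x)) := by
  have h := integral_rpow_mul_exp_neg_mul_rpow (p := 1/2) (q := 1) (b := 2) (by norm_num) (by norm_num)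
    (by norm_num)
  have e1 : ∀ y : ℝ, x * y * Real.exp (-x) * (Real.sqrt Real.pi * Real.exp (-2 * Real.sqrt y)) =
      (x * Real.exp (-x) * Real.sqrt Real.pi) * (y^(1:ℝ) * Real.exp (-2 * y^(1/2:ℝ))) := by
    intro y; rw [Real.rpow_one, Real.sqrt_eq_rpow y]; ring
  simp_rw [e1]
  rw [integral_const_mul, h]
  have e2 : (-((1:ℝ)+1)/(1/2)) = -((4:ℕ):ℝ) := by norm_num
  have e3 : (((1:ℝ)+1)/(1/2)) = ((3:ℕ):ℝ) + 1 := by norm_num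
  rw [e2, e3, Real.Gamma_nat_eq_factorial, Real.rpow_neg (by norm_num), Real.rpow_natCast]
  norm_num [Nat.factorial]
  ring

lemma log_u_limit : Tendsto (fun A => - Real.log (stdNormalCDF (-A)) / A^2) atTop (𝓝 (1/2)) := by
  have hinv : Tendsto (fun A : ℝ => A^2) atTop atTop := tendsto_pow_atTop (by norm_num)
  have h1 : Tendsto (fun A : ℝ => Real.log (Real.sqrt (2 * Real.pi)) / A^2) atTop (𝓝 0) :=
    Tendsto.const_div_atTop hinv _
  have h2 : Tendsto (fun A : ℝ => Real.log A / A^2) atTop (𝓝 0) := by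
    have := (Real.isLittleO_log_id_atTop.tendsto_div_nhds_zero).div_atTop tendsto_id
    refine this.congr fun A => ?_
    simp only [id]; rw [div_div, pow_two]
  have h3 : Tendsto (fun A : ℝ => Real.log (mills A) / A^2) atTop (𝓝 0) := by
    have := (Real.continuousAt_log (x := 1) (by norm_num)).tendsto.comp mills_tendsto
    exact this.div_atTop hinv
  have h4 := ((tendsto_const_nhds (x := (1/2:ℝ)) (f := atTop)).add h1).add (h2.sub h3)
  simp only [add_zero, sub_zero] at h4
  refine h4.congr' ?_
  filter_upwards [eventually_gt_atTop 0] with A hA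
  have hn := nphi_pos A
  have hm : 0 < mills A := by
    unfold mills; have := Phi_pos (-A); positivity
  have hl : Real.log (nphi A) = -A^2/2 - Real.log (Real.sqrt (2 * Real.pi)) := by
    unfold nphi
    rw [Real.log_div (Real.exp_pos _).ne' (by positivity), Real.log_exp]
  rw [Phi_mills hA, Real.log_div (by positivity) hA.ne', Real.log_mul hm.ne' hn.ne', hl]
  field_simp
  ring

lemma rpow_sq_three_half {a : ℝ} (ha : 0 ≤ a) : (a^2) ^ ((3:ℝ)/2) = a^3 := by
  rw [← Real.rpow_natCast a 2, ← Real.rpow_mul ha, ← Real.rpow_natCast a 3]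
  norm_num

lemma logN_limit {x : ℝ} (hx : 0 < x) :
    Tendsto (fun k : ℕ => (Real.log ((k:ℝ)+4)) ^ ((3:ℝ)/2) / (Ax x k)^3) atTop
      (𝓝 ((1/2:ℝ) ^ ((3:ℝ)/2))) := by
  have hA := Ax_tendsto hx
  have h1 := log_u_limit.comp hA
  have h2 : Tendsto (fun k => Real.log x / (Ax x k)^2) atTop (𝓝 0) :=
    Tendsto.const_div_atTop ((tendsto_pow_atTop (n := 2) (by norm_num)).comp hA) _
  have h3 := h1.add h2
  rw [add_zero] at h3
  have h4 := h3.rpow_const (p := (3:ℝ)/2) (Or.inl (by norm_num))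
  refine h4.congr' ?_
  filter_upwards [Ax_spec hx, hA.eventually (eventually_gt_atTop 0)] with k hk hk2
  simp only [Function.comp]
  have hN : (0:ℝ) < (k:ℝ) + 4 := by positivity
  rw [hk, Real.log_div hx.ne' hN.ne']
  have e : -(Real.log x - Real.log ((k:ℝ)+4)) / (Ax x k)^2 + Real.log x / (Ax x k)^2 =
      Real.log ((k:ℝ)+4) / (Ax x k)^2 := by ring
  have hk0 : (0:ℝ) ≤ k := Nat.cast_nonneg k
  rw [e, Real.div_rpow (Real.log_nonneg (by linarith)) (by positivity), rpow_sq_three_half hk2.le]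

lemma pointwise_limit {x : ℝ} (hx : 0 < x) :
    Tendsto (fun k : ℕ => ((k:ℝ)+4)^3 * (Real.log ((k:ℝ)+4)) ^ ((3:ℝ)/2) * Ik k (x / ((k:ℝ)+4))) atTop
      (𝓝 ((1/2:ℝ) ^ ((3:ℝ)/2) * (3/4 * Real.sqrt Real.pi) * (x^4 * Real.exp (-x)))) := by
  have hA := Ax_tendsto hx
  have hL := logN_limit hx
  have hN := near_limit hx
  rw [near_integral] at hN
  -- far part
  have hF : Tendsto (fun k : ℕ => (Real.log ((k:ℝ)+4)) ^ ((3:ℝ)/2) / (Ax x k)^3 *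
      ((Ax x k)^3 * ((k:ℝ)+4)^3 * ∫ w in Ioo (2 * (x / ((k:ℝ)+4))) 1,
      Dk k (x / ((k:ℝ)+4)) w * Hfun (x / ((k:ℝ)+4)) w)) atTop (𝓝 ((1/2:ℝ) ^ ((3:ℝ)/2) * 0)) := by
    refine hL.mul ?_
    have hup : Tendsto (fun k => (1000 * 5^8 * 40320) * x^3 / Ax x k) atTop (𝓝 0) :=
      Tendsto.const_div_atTop hA _
    refine squeeze_zero' ?_ ?_ hup
    · filter_upwards [hA.eventually (eventually_gt_atTop 0)] with k hk
      refine mul_nonneg (by positivity) ?_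
      refine setIntegral_nonneg measurableSet_Ioo fun w hw => ?_
      have : 0 < x / ((k:ℝ)+4) := by positivity
      exact mul_nonneg (Dk_nonneg k (by linarith [hw.1]) hw.2.le) (Hfun_nonneg _ w)
    · filter_upwards [Ax_spec hx, hA.eventually (eventually_ge_atTop 16)] with k hk hk2
      have hb := far_bound k hk2
      have hlt := Phi_lt_one (-(Ax x k))
      rw [hk] at hb hlt
      have hA0 : 0 < Ax x k := by linarith
      set u := x / ((k:ℝ)+4) with hu
      have hu0 : 0 < u := by positivity
      have hx' : x = u * ((k:ℝ)+4) := by rw [hu]; field_simp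
      have h4 : (1 - u)^k ≤ 1 := pow_le_one₀ (by linarith) (by linarith)
      calc _ ≤ (Ax x k)^3 * ((k:ℝ)+4)^3 * ((1000 * 5^8 * 40320) * (u^3 * (1 - u)^k) / (Ax x k)^4) := by
            gcongr
        _ ≤ (Ax x k)^3 * ((k:ℝ)+4)^3 * ((1000 * 5^8 * 40320) * (u^3 * 1) / (Ax x k)^4) := by
            gcongr
        _ = (1000 * 5^8 * 40320) * (u * ((k:ℝ)+4))^3 / Ax x k := by field_simp
        _ = _ := by rw [← hx']
  have hS := (hL.mul (hN.const_mul (x^3))).add hF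
  have e0 : (1/2:ℝ) ^ ((3:ℝ)/2) * (x^3 * (3/4 * Real.sqrt Real.pi * (x * Real.exp (-x)))) +
      (1/2:ℝ) ^ ((3:ℝ)/2) * 0 =
      (1/2:ℝ) ^ ((3:ℝ)/2) * (3/4 * Real.sqrt Real.pi) * (x^4 * Real.exp (-x)) := by ring
  rw [e0] at hS
  refine hS.congr' ?_
  filter_upwards [Ax_spec hx, hA.eventually (eventually_ge_atTop 16)] with k hk hk2
  have hA0 : 0 < Ax x k := by linarith
  have hid := near_id k hA0
  have hhalf := u_half hA0
  rw [hk] at hid hhalf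
  set u := x / ((k:ℝ)+4) with hu
  have hu0 : 0 < u := by positivity
  have hx' : x = u * ((k:ℝ)+4) := by rw [hu]; field_simp
  rw [Ik_split k hu0 hhalf, hid]
  have e1 : x^3 = u^3 * ((k:ℝ)+4)^3 := by rw [← mul_pow, ← hx']
  rw [e1]
  field_simp

lemma Ik_bound : ∃ C : ℝ, 0 ≤ C ∧ ∀ k : ℕ, ∀ u : ℝ, 0 < u → u < 1 →
    Ik k u * (1 - Real.log u) ^ ((3:ℝ)/2) ≤ C * ((1-u)^k * (((k:ℝ)+1) * u^4 + u^3)) := by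
  set C1 := 54 * (∫ y in Ioi 0, gdom y) with hC1
  have hC1' : 0 ≤ C1 := by
    refine mul_nonneg (by norm_num) (setIntegral_nonneg measurableSet_Ioi fun y hy => ?_)
    unfold gdom; have : 0 < y := hy
    positivity
  set C2 : ℝ := 1000 * 5^8 * 40320 with hC2
  have hC2' : 0 ≤ C2 := by rw [hC2]; positivity
  set u0 := stdNormalCDF (-16) with hu0
  have hu0p : 0 < u0 := Phi_pos _
  have hu01 : u0 < 1 := Phi_lt_one _
  set L0 := (1 - Real.log u0) ^ ((3:ℝ)/2) with hL0
  have hlog0 : Real.log u0 < 0 := Real.log_neg hu0p hu01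
  have hL0p : 0 ≤ L0 := Real.rpow_nonneg (by linarith) _
  refine ⟨8 * (C1 + C2) + L0 / u0^3, by positivity, ?_⟩
  intro k u hu hu1
  have h1u : 0 < 1 - u := by linarith
  have hlog : Real.log u < 0 := Real.log_neg hu hu1
  have hP : 0 ≤ (1-u)^k * (((k:ℝ)+1) * u^4 + u^3) := by positivity
  rcases lt_or_ge u u0 with h | h
  · obtain ⟨A, hA⟩ : ∃ A, stdNormalCDF (-A) = u := ⟨-stdNormalCDFInv u, by rw [neg_neg, Phi_Pinv hu hu1]⟩
    have hA16 : 16 ≤ A := by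
      rw [← hA, hu0] at h
      have := Phi_strictMono.lt_iff_lt.1 h
      linarith
    have hA0 : 0 < A := by linarith
    have hn := near_bound k (A := A) (by linarith)
    have hf := far_bound k hA16
    have hl := log_inv_le hA16
    have hh := u_half hA0
    rw [hA] at hn hf hl hh
    have hI : Ik k u ≤ (C1 + C2) * ((1-u)^k * (((k:ℝ)+1) * u^4 + u^3)) / A^3 := by
      rw [Ik_split k hu hh]
      have hf2 : C2 * (u^3 * (1-u)^k) / A^4 ≤ C2 * (u^3 * (1-u)^k) / A^3 := by
        apply div_le_div_of_nonneg_left (by positivity) (by positivity)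
        exact pow_le_pow_right₀ (by linarith) (by norm_num)
      calc _ ≤ C1 * (((k:ℝ)+1) * u^4 * (1 - u)^k) / A^3 + C2 * (u^3 * (1-u)^k) / A^3 :=
            add_le_add hn (hf.trans hf2)
        _ = ((C1 + C2) * ((1-u)^k * (((k:ℝ)+1) * u^4 + u^3)) -
             (C1 * ((1-u)^k * u^3) + C2 * ((1-u)^k * (((k:ℝ)+1) * u^4)))) / A^3 := by ring
        _ ≤ _ := by
            gcongr
            have : 0 ≤ C1 * ((1-u)^k * u^3) + C2 * ((1-u)^k * (((k:ℝ)+1) * u^4)) := by positivity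
            linarith
    have hLb : (1 - Real.log u) ^ ((3:ℝ)/2) ≤ 8 * A^3 := by
      calc _ ≤ ((2*A)^2) ^ ((3:ℝ)/2) := by
            apply Real.rpow_le_rpow (by linarith) _ (by norm_num)
            nlinarith
        _ = (2*A)^3 := rpow_sq_three_half (by linarith)
        _ = _ := by ring
    calc _ ≤ ((C1 + C2) * ((1-u)^k * (((k:ℝ)+1) * u^4 + u^3)) / A^3) * (8 * A^3) :=
          mul_le_mul hI hLb (Real.rpow_nonneg (by linarith) _) (by positivity)
      _ = 8 * (C1 + C2) * ((1-u)^k * (((k:ℝ)+1) * u^4 + u^3)) := by field_simp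
      _ ≤ _ := by
        gcongr
        have : 0 ≤ L0 / u0^3 := by positivity
        linarith
  · have hI := Ik_le k hu hu1
    have hLb : (1 - Real.log u) ^ ((3:ℝ)/2) ≤ L0 := by
      apply Real.rpow_le_rpow (by linarith) _ (by norm_num)
      have := Real.log_le_log hu0p h
      linarith
    calc _ ≤ (1-u)^k * L0 := mul_le_mul hI hLb (Real.rpow_nonneg (by linarith) _) (by positivity)
      _ = L0 / u0^3 * ((1-u)^k * u0^3) := by field_simp
      _ ≤ L0 / u0^3 * ((1-u)^k * (((k:ℝ)+1) * u^4 + u^3)) := by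
        gcongr
        have : u0^3 ≤ u^3 := by gcongr
        have : 0 ≤ ((k:ℝ)+1) * u^4 := by positivity
        linarith
      _ ≤ _ := by
        gcongr
        have : 0 ≤ 8 * (C1 + C2) := by positivity
        linarith


lemma pow_exp_integrable (n : ℕ) : IntegrableOn (fun x : ℝ => x^n * Real.exp (-x)) (Ioi 0) := by
  have h := Real.GammaIntegral_convergent (s := (n:ℝ)+1) (by positivity)
  refine h.congr_fun (fun x hx => ?_) measurableSet_Ioi
  simp only [add_sub_cancel_right, Real.rpow_natCast]
  ring

lemma pow4_exp_integral : ∫ x in Ioi (0:ℝ), x^4 * Real.exp (-x) = 24 := by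
  have h := Real.Gamma_eq_integral (s := ((4:ℕ):ℝ)+1) (by positivity)
  rw [Real.Gamma_nat_eq_factorial] at h
  have : ((Nat.factorial 4 : ℕ):ℝ) = 24 := by norm_num [Nat.factorial]
  rw [← this, h]
  refine setIntegral_congr_fun measurableSet_Ioi (fun x hx => ?_)
  simp only [add_sub_cancel_right, Real.rpow_natCast]
  ring

noncomputable def Kk (k : ℕ) (x : ℝ) : ℝ :=
  (Ioo (0:ℝ) ((k:ℝ)+4)).indicator (fun x => ((k:ℝ)+4)^3 * (Real.log ((k:ℝ)+4))^((3:ℝ)/2) *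
    Ik k (x/((k:ℝ)+4))) x

lemma Kk_dom (C : ℝ) (hC : 0 ≤ C)
    (hb : ∀ (k : ℕ) (u : ℝ), 0 < u → u < 1 →
      Ik k u * (1 - Real.log u)^((3:ℝ)/2) ≤ C * ((1-u)^k * (((k:ℝ)+1)*u^4 + u^3)))
    (k : ℕ) {x : ℝ} (hx : 0 < x) :
    ‖Kk k x‖ ≤ C * Real.exp 4 * (x^3 * Real.exp (-x) + 3 * (x^4 * Real.exp (-x)) +
      3 * (x^5 * Real.exp (-x)) + x^6 * Real.exp (-x)) := by
  unfold Kk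
  by_cases hm : x ∈ Ioo (0:ℝ) ((k:ℝ)+4)
  swap
  · rw [indicator_of_notMem hm, norm_zero]; positivity
  rw [indicator_of_mem hm]
  set N : ℝ := (k:ℝ)+4 with hN
  have hk0 : (0:ℝ) ≤ k := Nat.cast_nonneg k
  have hN0 : 0 < N := by positivity
  have hN1 : 1 ≤ N := by linarith
  have hL0 : 0 ≤ Real.log N := Real.log_nonneg hN1
  set u := x / N with hu
  have hu0 : 0 < u := by positivity
  have hu1 : u < 1 := (div_lt_one hN0).2 hm.2
  have hI : 0 ≤ Ik k u := Ik_nonneg k u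
  have hlu : Real.log u = Real.log x - Real.log N := Real.log_div hx.ne' hN0.ne'
  have hlu0 : Real.log u < 0 := Real.log_neg hu0 hu1
  have hlx : Real.log x ≤ x - 1 := Real.log_le_sub_one_of_pos hx
  have h1 : Real.log N ≤ (1+x) * (1 - Real.log u) := by nlinarith
  have h2 : (Real.log N)^((3:ℝ)/2) ≤ (1+x)^2 * (1 - Real.log u)^((3:ℝ)/2) := by
    calc (Real.log N)^((3:ℝ)/2) ≤ ((1+x) * (1 - Real.log u))^((3:ℝ)/2) :=
          Real.rpow_le_rpow hL0 h1 (by norm_num)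
      _ = (1+x)^((3:ℝ)/2) * (1 - Real.log u)^((3:ℝ)/2) :=
          Real.mul_rpow (by linarith) (by linarith)
      _ ≤ _ := by
          have h3 : (1+x)^((3:ℝ)/2) ≤ (1+x)^(2:ℝ) :=
            Real.rpow_le_rpow_of_exponent_le (by linarith) (by norm_num)
          rw [Real.rpow_two] at h3
          exact mul_le_mul_of_nonneg_right h3 (Real.rpow_nonneg (by linarith) _)
  have h4 : (1-u)^k ≤ Real.exp 4 * Real.exp (-x) := by
    calc (1-u)^k ≤ (Real.exp (-u))^k :=
          pow_le_pow_left₀ (by linarith) (Real.one_sub_le_exp_neg u) k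
      _ = Real.exp (-(k*u)) := by rw [← Real.exp_nat_mul]; ring_nf
      _ ≤ Real.exp (4 + -x) := by
          apply Real.exp_le_exp.2
          have : x = u * N := by rw [hu]; field_simp
          rw [this, hN]; nlinarith
      _ = _ := Real.exp_add _ _
  have h5 : N^3 * (((k:ℝ)+1)*u^4 + u^3) ≤ x^4 + x^3 := by
    have e : x = u * N := by rw [hu]; field_simp
    rw [e, mul_pow, mul_pow]
    have : ((k:ℝ)+1) ≤ N := by linarith
    have : N^3 * (((k:ℝ)+1)*u^4) ≤ N^3 * (N*u^4) := by gcongr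
    nlinarith
  have hLn : 0 ≤ (Real.log N)^((3:ℝ)/2) := Real.rpow_nonneg hL0 _
  rw [Real.norm_of_nonneg (by positivity)]
  have hbk := hb k u hu0 hu1
  have h1u : 0 ≤ 1 - u := by linarith
  calc N^3 * (Real.log N)^((3:ℝ)/2) * Ik k u
      ≤ N^3 * ((1+x)^2 * (1 - Real.log u)^((3:ℝ)/2)) * Ik k u := by gcongr
    _ = N^3 * (1+x)^2 * (Ik k u * (1 - Real.log u)^((3:ℝ)/2)) := by ring
    _ ≤ N^3 * (1+x)^2 * (C * ((1-u)^k * (((k:ℝ)+1)*u^4 + u^3))) := by gcongr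
    _ = C * (1+x)^2 * (1-u)^k * (N^3 * (((k:ℝ)+1)*u^4 + u^3)) := by ring
    _ ≤ C * (1+x)^2 * (Real.exp 4 * Real.exp (-x)) * (x^4 + x^3) := by gcongr
    _ = _ := by ring

lemma Kk_limit : Tendsto (fun k => ∫ x in Ioi 0, Kk k x) atTop
    (𝓝 ((1/2:ℝ)^((3:ℝ)/2) * (3/4*Real.sqrt Real.pi) * 24)) := by
  obtain ⟨C, hC, hb⟩ := Ik_bound
  have hlim : (1/2:ℝ)^((3:ℝ)/2) * (3/4*Real.sqrt Real.pi) * 24 =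
      ∫ x in Ioi (0:ℝ), (1/2:ℝ)^((3:ℝ)/2) * (3/4*Real.sqrt Real.pi) * (x^4 * Real.exp (-x)) := by
    rw [integral_const_mul, pow4_exp_integral]
  rw [hlim]
  refine tendsto_integral_of_dominated_convergence
    (fun x => C * Real.exp 4 * (x^3 * Real.exp (-x) + 3 * (x^4 * Real.exp (-x)) +
      3 * (x^5 * Real.exp (-x)) + x^6 * Real.exp (-x))) ?_ ?_ ?_ ?_
  · intro k
    apply Measurable.aestronglyMeasurable
    unfold Kk
    refine Measurable.indicator ?_ measurableSet_Ioo
    exact ((Ik_measurable k).comp (measurable_id.div_const _)).const_mul _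
  · exact ((((pow_exp_integrable 3).add ((pow_exp_integrable 4).const_mul 3)).add
      ((pow_exp_integrable 5).const_mul 3)).add (pow_exp_integrable 6)).const_mul _
  · intro k
    exact (ae_restrict_iff' measurableSet_Ioi).2 (Eventually.of_forall fun x hx =>
      Kk_dom C hC hb k hx)
  · refine (ae_restrict_iff' measurableSet_Ioi).2 (Eventually.of_forall fun x hx => ?_)
    have hx : 0 < x := hx
    refine (pointwise_limit hx).congr' ?_
    filter_upwards [tendsto_natCast_atTop_atTop.eventually (eventually_gt_atTop x)] with k hk
    unfold Kk
    rw [indicator_of_mem (show x ∈ Ioo (0:ℝ) ((k:ℝ)+4) from ⟨hx, by linarith⟩)]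

lemma Kk_integral (k : ℕ) : ∫ x in Ioi 0, Kk k x =
    ((k:ℝ)+4)^3 * (Real.log ((k:ℝ)+4))^((3:ℝ)/2) * (((k:ℝ)+4) * ∫ u in Ioo (0:ℝ) 1, Ik k u) := by
  have hk0 : (0:ℝ) ≤ k := Nat.cast_nonneg k
  have hN0 : 0 < (k:ℝ)+4 := by positivity
  unfold Kk
  rw [setIntegral_indicator measurableSet_Ioo,
    inter_eq_self_of_subset_right (fun x hx => hx.1), integral_const_mul]
  congr 1
  rw [← integral_Ioc_eq_integral_Ioo, ← integral_Ioc_eq_integral_Ioo,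
    ← intervalIntegral.integral_of_le hN0.le, ← intervalIntegral.integral_of_le zero_le_one,
    intervalIntegral.integral_comp_div _ hN0.ne', zero_div, div_self hN0.ne', smul_eq_mul]

lemma final_const : (1/2:ℝ)^((3:ℝ)/2) * (3/4*Real.sqrt Real.pi) * 24 =
    9 * Real.sqrt (Real.pi / 2) := by
  have h : (1/2:ℝ)^((3:ℝ)/2) = 1/2 * Real.sqrt (1/2) := by
    rw [show ((3:ℝ)/2) = 1 + 1/2 by norm_num, Real.rpow_add (by norm_num), Real.rpow_one,
      ← Real.sqrt_eq_rpow]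
  rw [h, show Real.pi / 2 = Real.pi * (1/2) by ring, Real.sqrt_mul Real.pi_pos.le]
  ring

lemma ratio_limit : Tendsto (fun k : ℕ => (1 - 1/((k:ℝ)+4)) * (1 - 2/((k:ℝ)+4))) atTop (𝓝 1) := by
  have h : Tendsto (fun k : ℕ => (k:ℝ)+4) atTop atTop :=
    tendsto_atTop_add_const_right _ _ tendsto_natCast_atTop_atTop
  have h1 := (h.const_div_atTop 1).const_sub 1
  have h2 := (h.const_div_atTop 2).const_sub 1
  simpa using h1.mul h2

lemma inner_eq (k : ℕ) (u : ℝ) : ∫ w in Set.Ioo u 1,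
    (1 - w) * ((1 - u) ^ (k+1) - (1 - w) ^ (k+1)) * Gavg u w = Ik k u := by
  unfold Ik
  refine setIntegral_congr_fun measurableSet_Ioo (fun w hw => ?_)
  have : 1 - w ≠ 0 := by have := hw.2; intro h; linarith
  simp only [Gavg, Dk, Hfun]
  field_simp

/-- Intensity of the remaining pairs: with
`J_n = n(n−1)(n−2)∫₀¹∫_u^1 (1−w)[(1−u)^{n−3} − (1−w)^{n−3}] G(u,w) dw du`,
one has `n(log n)^{3/2} · J_n → 9√(π/2)`. -/
theorem remaining_pairs_intensity_asymptotics :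
    Tendsto (fun n : ℕ =>
        (n : ℝ) * (Real.log n) ^ ((3 : ℝ) / 2) *
          ((n : ℝ) * ((n : ℝ) - 1) * ((n : ℝ) - 2) *
            ∫ u in Set.Ioo (0 : ℝ) 1, ∫ w in Set.Ioo u 1,
              (1 - w) * ((1 - u) ^ (n - 3) - (1 - w) ^ (n - 3)) * Gavg u w))
      atTop (nhds (9 * Real.sqrt (Real.pi / 2))) := by
  rw [← tendsto_add_atTop_iff_nat 4, ← final_const]
  have h := ratio_limit.mul Kk_limit
  rw [one_mul] at h
  refine h.congr fun k => ?_
  have hk0 : (0:ℝ) ≤ k := Nat.cast_nonneg k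
  have hN0 : (k:ℝ)+4 ≠ 0 := by positivity
  have e : k + 4 - 3 = k + 1 := by omega
  simp only [e, inner_eq]
  rw [Kk_integral]
  push_cast
  field_simp
end

section
/- Fix an integer k ≥ 3. There exists a constant C_k < ∞ such that, for all sufficiently large n, the probability under the GOE model that some global minimizer of x ↦ xᵀQx over Δ^{n-1} has support of cardinality exactly k satisfies μ_n{Q : ∃ x ∈ Δ^{n-1}, x is a global minimizer over Δ^{n-1} and |{i : x_i > 0}| = k} ≤ C_k · n^{2−k−2/(k+1)} (log n)^{k−3/2+1/(k+1)}. In particular, for k = 3 this probability is at most C (log n)^{7/4} / n^{3/2}. -/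
open MeasureTheory ProbabilityTheory Filter Matrix

/-- Build a symmetric matrix from diagonal coordinates and strictly
upper-triangular coordinates. -/
noncomputable def goeMatrix (n : ℕ)
    (d : Fin n → ℝ) (o : {p : Fin n × Fin n // p.1 < p.2} → ℝ) :
    Matrix (Fin n) (Fin n) ℝ :=
  fun i j =>
    if h : i = j then d i
    else if h' : i < j then o ⟨(i, j), h'⟩
    else o ⟨(j, i), lt_of_le_of_ne (not_lt.mp h') (Ne.symm h)⟩

instance matrixMeasurableSpace (n : ℕ) :
    MeasurableSpace (Matrix (Fin n) (Fin n) ℝ) := by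
  unfold Matrix; infer_instance

/-- The GOE model: the pushforward, under the symmetric-matrix assembly map, of
the product Gaussian measure with `N(0,1)` diagonal coordinates and `N(0,1/2)`
strictly upper-triangular coordinates. -/
noncomputable def goeMeasure (n : ℕ) : Measure (Matrix (Fin n) (Fin n) ℝ) :=
  ((Measure.pi fun _ : Fin n => gaussianReal 0 1).prod
      (Measure.pi fun _ : {p : Fin n × Fin n // p.1 < p.2} =>
        gaussianReal 0 (1 / 2))).map
    (fun dq => goeMatrix n dq.1 dq.2)


/-- Frobenius lower bound. -/
lemma goe_frob_bound {ι : Type*} (S : Finset ι) (Q : ι → ι → ℝ) (x : ι → ℝ) (c L : ℝ)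
    (hx : ∀ i ∈ S, 0 ≤ x i) (hsum : ∑ i ∈ S, x i = 1) (hsymm : ∀ i j, Q i j = Q j i)
    (hQ : ∀ i ∈ S, ∑ j ∈ S, Q i j * x j = c) (hL : 0 ≤ L) (hc : c ≤ -L) :
    (2 * (S.card : ℝ) - 1) * L ^ 2 ≤ ∑ i ∈ S, ∑ j ∈ S, Q i j ^ 2 := by
  set q := ∑ i ∈ S, x i ^ 2 with hq
  set k : ℝ := (S.card : ℝ) with hk
  have hcs : 1 ≤ k * q := by
    have := sq_sum_le_card_mul_sum_sq (s := S) (f := x)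
    rw [hsum] at this; simpa using this
  have hx1 : ∀ i ∈ S, x i ≤ 1 := fun i hi => hsum ▸ Finset.single_le_sum hx hi
  have hq1 : q ≤ 1 := by
    rw [← hsum]
    exact Finset.sum_le_sum fun i hi => by nlinarith [hx i hi, hx1 i hi]
  have hk0 : 0 ≤ k := Nat.cast_nonneg _
  have hq0 : 0 < q := by
    by_contra h
    nlinarith
  set s := 1 / q with hs
  have hsq : s * q = 1 := by rw [hs]; field_simp
  have hs1 : 1 ≤ s := by rw [hs, le_div_iff₀ hq0]; linarith
  have hsk : s ≤ k := by rw [hs, div_le_iff₀ hq0]; linarith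
  set y : ι → ℝ := fun i => c * s * (1 - s * x i / 2) with hy
  have hysum : ∑ i ∈ S, y i = c * s * (k - s / 2) := by
    simp only [hy, ← Finset.mul_sum, Finset.sum_sub_distrib, ← Finset.sum_div, hsum]
    simp [hk]
  have hxy : ∑ i ∈ S, x i * y i = c * s / 2 := by
    have : ∀ i ∈ S, x i * y i = c * s * x i - c * s * s / 2 * x i ^ 2 := fun i _ => by
      simp only [hy]; ring
    rw [Finset.sum_congr rfl this, Finset.sum_sub_distrib, ← Finset.mul_sum, ← Finset.mul_sum,
      hsum, ← hq]
    linear_combination (-(c * s / 2)) * hsq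
  have hyy : ∑ i ∈ S, y i ^ 2 = c ^ 2 * s ^ 2 * (k - 3 * s / 4) := by
    have : ∀ i ∈ S, y i ^ 2 = c ^ 2 * s ^ 2 - c ^ 2 * s ^ 3 * x i
        + c ^ 2 * s ^ 4 / 4 * x i ^ 2 := fun i _ => by
      simp only [hy]; ring
    rw [Finset.sum_congr rfl this, Finset.sum_add_distrib, Finset.sum_sub_distrib,
      Finset.sum_const, nsmul_eq_mul, ← hk, ← Finset.mul_sum, ← Finset.mul_sum,
      hsum, ← hq]
    linear_combination (c ^ 2 * s ^ 3 / 4) * hsq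
  have hQy : ∑ i ∈ S, ∑ j ∈ S, Q i j * (y i * x j) = c * (c * s * (k - s / 2)) := by
    rw [← hysum, Finset.mul_sum]
    refine Finset.sum_congr rfl fun i hi => ?_
    rw [← hQ i hi, Finset.sum_mul]
    exact Finset.sum_congr rfl fun j _ => by ring
  have hQy' : ∑ i ∈ S, ∑ j ∈ S, Q i j * (x i * y j) = c * (c * s * (k - s / 2)) := by
    rw [← hQy, Finset.sum_comm]
    refine Finset.sum_congr rfl fun i _ => Finset.sum_congr rfl fun j _ => ?_
    rw [hsymm]; ring
  have e1 : ∑ i ∈ S, ∑ j ∈ S, x i ^ 2 * y j ^ 2 = q * (c ^ 2 * s ^ 2 * (k - 3 * s / 4)) := by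
    rw [← hyy, hq, Finset.sum_mul_sum]
  have e2 : ∑ i ∈ S, ∑ j ∈ S, y i ^ 2 * x j ^ 2 = q * (c ^ 2 * s ^ 2 * (k - 3 * s / 4)) := by
    rw [← hyy, hq, mul_comm, Finset.sum_mul_sum]
  have e3 : ∑ i ∈ S, ∑ j ∈ S, (x i * y i) * (x j * y j) = (c * s / 2) ^ 2 := by
    rw [← hxy, sq, Finset.sum_mul_sum]
  have key : 0 ≤ ∑ i ∈ S, ∑ j ∈ S, (Q i j - (x i * y j + y i * x j)) ^ 2 :=
    Finset.sum_nonneg fun i _ => Finset.sum_nonneg fun j _ => sq_nonneg _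
  have exp : ∑ i ∈ S, ∑ j ∈ S, (Q i j - (x i * y j + y i * x j)) ^ 2 =
      ∑ i ∈ S, ∑ j ∈ S, Q i j ^ 2 - 2 * ∑ i ∈ S, ∑ j ∈ S, Q i j * (x i * y j)
      - 2 * ∑ i ∈ S, ∑ j ∈ S, Q i j * (y i * x j)
      + ∑ i ∈ S, ∑ j ∈ S, x i ^ 2 * y j ^ 2 + ∑ i ∈ S, ∑ j ∈ S, y i ^ 2 * x j ^ 2
      + 2 * ∑ i ∈ S, ∑ j ∈ S, (x i * y i) * (x j * y j) := by
    simp only [Finset.mul_sum, ← Finset.sum_add_distrib, ← Finset.sum_sub_distrib]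
    refine Finset.sum_congr rfl fun i _ => Finset.sum_congr rfl fun j _ => ?_
    ring
  rw [exp, hQy, hQy', e1, e2, e3] at key
  have h2 : q * (c ^ 2 * s ^ 2 * (k - 3 * s / 4)) = c ^ 2 * s * (k - 3 * s / 4) := by
    linear_combination (c ^ 2 * s * (k - 3 * s / 4)) * hsq
  rw [h2] at key
  have h3 : c ^ 2 * (2 * k * s - s ^ 2) ≤ ∑ i ∈ S, ∑ j ∈ S, Q i j ^ 2 := by linarith
  refine le_trans ?_ h3
  have h4 : 2 * k - 1 ≤ 2 * k * s - s ^ 2 := by nlinarith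
  have h5 : L ^ 2 ≤ c ^ 2 := by nlinarith
  have h6 : 0 ≤ 2 * k - 1 := by linarith
  nlinarith [mul_le_mul h4 h5 (sq_nonneg L) (h6.trans h4)]

/-- KKT at a minimizer. -/
lemma goe_kkt {n : ℕ} (Q : Matrix (Fin n) (Fin n) ℝ) (hsymm : ∀ i j, Q i j = Q j i)
    (x : Fin n → ℝ) (hx : x ∈ stdSimplex ℝ (Fin n))
    (hmin : ∀ y ∈ stdSimplex ℝ (Fin n), x ⬝ᵥ Q.mulVec x ≤ y ⬝ᵥ Q.mulVec y)
    (i j : Fin n) (hi : 0 < x i) : Q.mulVec x i ≤ Q.mulVec x j := by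
  by_cases hij : i = j
  · rw [hij]
  set e : Fin n → ℝ := Pi.single j 1 - Pi.single i 1 with he
  have hQT : ∀ u v : Fin n → ℝ, u ⬝ᵥ Q.mulVec v = v ⬝ᵥ Q.mulVec u := by
    intro u v
    have : Qᵀ = Q := by ext a b; exact hsymm b a
    rw [Matrix.dotProduct_mulVec, ← Matrix.mulVec_transpose, this, dotProduct_comm]
  have hmem : ∀ t : ℝ, 0 ≤ t → t ≤ x i → x + t • e ∈ stdSimplex ℝ (Fin n) := by
    intro t ht hti
    refine ⟨fun l => ?_, ?_⟩
    · have := hx.1 l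
      simp only [he, Pi.add_apply, Pi.smul_apply, Pi.sub_apply, Pi.single_apply, smul_eq_mul]
      by_cases h1 : l = i
      · subst h1; simp [hij, hti]
      · simp only [h1, if_false]; split_ifs <;> simp <;> linarith
    · simp [he, Finset.sum_add_distrib, ← Finset.mul_sum, hx.2]
  have hval : ∀ t : ℝ, 0 ≤ t → t ≤ x i →
      0 ≤ 2 * t * (e ⬝ᵥ Q.mulVec x) + t ^ 2 * (e ⬝ᵥ Q.mulVec e) := by
    intro t ht hti
    have := hmin _ (hmem t ht hti)
    simp only [Matrix.mulVec_add, Matrix.mulVec_smul, dotProduct_add, add_dotProduct,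
      dotProduct_smul, smul_dotProduct, smul_eq_mul] at this
    rw [hQT x e] at this
    linarith
  have hex : e ⬝ᵥ Q.mulVec x = Q.mulVec x j - Q.mulVec x i := by
    simp [he, sub_dotProduct]
  by_contra hlt
  push Not at hlt
  set g := e ⬝ᵥ Q.mulVec x
  set b := e ⬝ᵥ Q.mulVec e
  have hg : g < 0 := by rw [hex]; linarith
  set t := min (x i) (-g / (|b| + 1)) with htd
  have hb : 0 < |b| + 1 := by positivity
  have ht0 : 0 < t := lt_min hi (div_pos (by linarith) hb)
  have h1 := hval t ht0.le (min_le_left _ _)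
  have h2 : t * (|b| + 1) ≤ -g := by
    rw [← le_div_iff₀ hb]; exact min_le_right _ _
  have h3 : 0 ≤ 2 * g + t * b := by
    by_contra h
    push Not at h
    nlinarith
  have h4 : t * b ≤ t * |b| := mul_le_mul_of_nonneg_left (le_abs_self b) ht0.le
  nlinarith

lemma goe_det {n k : ℕ} (Q : Matrix (Fin n) (Fin n) ℝ) (hsymm : ∀ i j, Q i j = Q j i)
    (x : Fin n → ℝ) (hx : x ∈ stdSimplex ℝ (Fin n))
    (hmin : ∀ y ∈ stdSimplex ℝ (Fin n), x ⬝ᵥ Q.mulVec x ≤ y ⬝ᵥ Q.mulVec y)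
    (hcard : {i | 0 < x i}.ncard = k) (L : ℝ) (hL : 0 ≤ L) (l : Fin n) (hl : Q l l ≤ -L) :
    ∃ S ∈ Finset.powersetCard k (Finset.univ : Finset (Fin n)),
      (2 * (k : ℝ) - 1) * L ^ 2 ≤ ∑ i ∈ S, ∑ j ∈ S, Q i j ^ 2 := by
  classical
  set S : Finset (Fin n) := Finset.univ.filter fun i => 0 < x i with hS
  have hSc : S.card = k := by
    rw [← hcard, ← Set.ncard_coe_finset]; congr; ext; simp [hS]
  refine ⟨S, by simp [hSc], ?_⟩
  have hout : ∀ f : Fin n → ℝ, ∑ j ∈ S, f j * x j = ∑ j, f j * x j := by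
    intro f
    refine Finset.sum_subset (Finset.subset_univ _) fun j _ hj => ?_
    have : x j = 0 := le_antisymm (by simpa [hS] using hj) (hx.1 j)
    simp [this]
  have hmv : ∀ i ∈ S, Q.mulVec x i = x ⬝ᵥ Q.mulVec x := by
    intro i hi
    have h1 : ∀ j ∈ S, Q.mulVec x j = Q.mulVec x i := fun j hj =>
      le_antisymm (goe_kkt Q hsymm x hx hmin j i (by simpa [hS] using hj))
        (goe_kkt Q hsymm x hx hmin i j (by simpa [hS] using hi))
    have h2 : x ⬝ᵥ Q.mulVec x = ∑ j ∈ S, Q.mulVec x j * x j := by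
      rw [hout, dotProduct_comm]; rfl
    rw [h2, Finset.sum_congr rfl fun j hj => by rw [h1 j hj], ← Finset.mul_sum]
    have := hout fun _ => 1
    simp only [one_mul] at this
    rw [this, hx.2, mul_one]
  have hc : x ⬝ᵥ Q.mulVec x ≤ -L := by
    have := hmin _ (single_mem_stdSimplex ℝ l)
    refine this.trans (le_trans (le_of_eq ?_) hl)
    simp
  rw [← hSc]
  refine goe_frob_bound S Q x (x ⬝ᵥ Q.mulVec x) L (fun i _ => hx.1 i) ?_ hsymm ?_ hL hc
  · have := hout fun _ => 1
    simp only [one_mul] at this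
    rw [this, hx.2]
  · intro i hi
    rw [hout, ← hmv i hi]; rfl

lemma goeMatrix_symm (n : ℕ) (d : Fin n → ℝ) (o : {p : Fin n × Fin n // p.1 < p.2} → ℝ)
    (i j : Fin n) : goeMatrix n d o i j = goeMatrix n d o j i := by
  unfold goeMatrix
  rcases lt_trichotomy i j with h | h | h
  · simp [h.ne, h.ne', h, h.not_gt]
  · subst h; rfl
  · simp [h.ne, h.ne', h, h.not_gt]

lemma goeMatrix_measurable (n : ℕ) :
    Measurable (fun dq : (Fin n → ℝ) × ({p : Fin n × Fin n // p.1 < p.2} → ℝ) =>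
      goeMatrix n dq.1 dq.2) := by
  refine measurable_pi_lambda _ fun i => measurable_pi_lambda _ fun j => ?_
  unfold goeMatrix
  by_cases h : i = j
  · simp only [h, dite_true]; fun_prop
  · by_cases h' : i < j
    · simp only [h, h', dite_true, dite_false]; fun_prop
    · simp only [h, h', dite_false]; fun_prop

lemma goe_entry_measurable (n : ℕ) (i j : Fin n) :
    Measurable (fun Q : Matrix (Fin n) (Fin n) ℝ => Q i j) :=
  (measurable_pi_apply (X := fun _ : Fin n => ℝ) j).comp
    (measurable_pi_apply (X := fun _ : Fin n => Fin n → ℝ) i)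

lemma goe_ae_symm (n : ℕ) : ∀ᵐ Q ∂(goeMeasure n), ∀ i j, Q i j = Q j i := by
  unfold goeMeasure
  rw [ae_map_iff (goeMatrix_measurable n).aemeasurable]
  · exact ae_of_all _ fun dq i j => goeMatrix_symm n _ _ i j
  · simp only [Set.ofPred_forall]
    exact MeasurableSet.iInter fun i => MeasurableSet.iInter fun j =>
      measurableSet_eq_fun (goe_entry_measurable n i j) (goe_entry_measurable n j i)

lemma goe_sum_sq (n : ℕ) (d : Fin n → ℝ) (o : {p : Fin n × Fin n // p.1 < p.2} → ℝ)
    (S : Finset (Fin n)) :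
    ∑ i ∈ S, ∑ j ∈ S, goeMatrix n d o i j ^ 2 =
      ∑ i ∈ S, d i ^ 2 + 2 * ∑ p ∈ (S ×ˢ S).subtype (fun p => p.1 < p.2), o p ^ 2 := by
  set F : Fin n → Fin n → ℝ := fun i j => if h : i < j then o ⟨(i, j), h⟩ ^ 2 else 0 with hF
  have h1 : ∀ i j, goeMatrix n d o i j ^ 2 = (if i = j then d i ^ 2 else 0) + F i j + F j i := by
    intro i j
    simp only [hF, goeMatrix]
    rcases lt_trichotomy i j with h | h | h
    · simp [h.ne, h, h.not_gt]
    · subst h; simp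
    · simp [h.ne', h, h.not_gt]
  have h2 : ∑ p ∈ (S ×ˢ S).subtype (fun p => p.1 < p.2), o p ^ 2 = ∑ i ∈ S, ∑ j ∈ S, F i j := by
    rw [← Finset.sum_product' S S F]
    rw [← Finset.sum_filter_of_ne (s := S ×ˢ S) (p := fun p => p.1 < p.2)
      (f := fun p => F p.1 p.2)]
    · rw [← Finset.sum_subtype_eq_sum_filter]
      refine Finset.sum_congr rfl fun p _ => ?_
      simp [hF, p.2]
    · intro p _ hp
      by_contra h
      exact hp (by simp [hF, h])
  simp only [h1, Finset.sum_add_distrib, h2]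
  rw [Finset.sum_comm (f := fun i j => F j i)]
  have : ∑ i ∈ S, ∑ j ∈ S, (if i = j then d i ^ 2 else 0) = ∑ i ∈ S, d i ^ 2 :=
    Finset.sum_congr rfl fun i hi => by simp [hi]
  rw [this]; ring

lemma goe_lintegral_pi {ι : Type*} [Fintype ι] (ν : Measure ℝ) [IsProbabilityMeasure ν]
    (f : ℝ → ENNReal) (hf : Measurable f) (s : Finset ι) :
    ∫⁻ ω, ∏ i ∈ s, f (ω i) ∂(Measure.pi fun _ : ι => ν) = (∫⁻ x, f x ∂ν) ^ s.card := by
  have h := lintegral_prod_eq_prod_lintegral_of_indepFun (μ := Measure.pi fun _ : ι => ν) s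
    (fun i (ω : ι → ℝ) => f (ω i))
    (iIndepFun_pi (μ := fun _ : ι => ν) (X := fun _ => f) fun _ => hf.aemeasurable)
    (fun i => hf.comp (measurable_pi_apply i))
  rw [h]
  rw [Finset.prod_congr rfl fun i _ =>
    (measurePreserving_eval (fun _ : ι => ν) i).lintegral_comp hf]
  simp

lemma goe_exp_sq_finite (v : NNReal) (hv : v ≠ 0) (a : ℝ) (ha : a < 1 / (2 * v)) :
    ∫⁻ x, ENNReal.ofReal (Real.exp (a * x ^ 2)) ∂(gaussianReal 0 v) < ⊤ := by
  rw [gaussianReal_of_var_ne_zero _ hv,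
    lintegral_withDensity_eq_lintegral_mul _ (measurable_gaussianPDF _ _) (by fun_prop)]
  have hInteg : Integrable (fun x : ℝ => (√(2 * Real.pi * v))⁻¹ *
      Real.exp (-(1 / (2 * v) - a) * x ^ 2)) :=
    (integrable_exp_neg_mul_sq (by linarith)).const_mul _
  refine lt_of_le_of_lt (le_of_eq ?_) hInteg.lintegral_lt_top
  refine lintegral_congr fun x => ?_
  simp only [Pi.mul_apply, gaussianPDF, gaussianPDFReal]
  rw [← ENNReal.ofReal_mul (by positivity), mul_assoc, ← Real.exp_add]
  congr 3
  field_simp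
  ring

lemma goe_chernoff (k : ℕ) (θ : ℝ) (hθ0 : 0 ≤ θ) (hθ : θ < 1) :
    ∃ C : ℝ, 0 ≤ C ∧ ∀ (n : ℕ) (S : Finset (Fin n)), S.card = k → ∀ R : ℝ,
      goeMeasure n {Q | R ≤ ∑ i ∈ S, ∑ j ∈ S, Q i j ^ 2} ≤
        ENNReal.ofReal (C * Real.exp (-(θ / 2 * R))) := by
  set K1 := ∫⁻ x, ENNReal.ofReal (Real.exp (θ / 2 * x ^ 2)) ∂(gaussianReal 0 1) with hK1
  set K2 := ∫⁻ x, ENNReal.ofReal (Real.exp (θ * x ^ 2)) ∂(gaussianReal 0 (1 / 2)) with hK2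
  have h1 : K1 < ⊤ := goe_exp_sq_finite 1 one_ne_zero _ (by norm_num; linarith)
  have h2 : K2 < ⊤ := goe_exp_sq_finite (1 / 2) (by norm_num) _ (by push_cast; norm_num; linarith)
  set M := max 1 (max K1 K2) with hM
  have hMtop : M < ⊤ := by simp [hM, h1, h2]
  have hM1 : 1 ≤ M := le_max_left _ _
  refine ⟨(M ^ (k + k * k)).toReal, ENNReal.toReal_nonneg, fun n S hS R => ?_⟩
  have hmeas : MeasurableSet {Q : Matrix (Fin n) (Fin n) ℝ |
      R ≤ ∑ i ∈ S, ∑ j ∈ S, Q i j ^ 2} := by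
    refine measurableSet_le measurable_const ?_
    exact Finset.measurable_sum _ fun i _ => Finset.measurable_sum _ fun j _ =>
      (goe_entry_measurable n i j).pow_const 2
  unfold goeMeasure
  rw [Measure.map_apply (goeMatrix_measurable n) hmeas]
  set T := (S ×ˢ S).subtype (fun p : Fin n × Fin n => p.1 < p.2) with hT
  set f : (Fin n → ℝ) → ENNReal :=
    fun d => ∏ i ∈ S, ENNReal.ofReal (Real.exp (θ / 2 * (d i) ^ 2)) with hf
  set g : ({p : Fin n × Fin n // p.1 < p.2} → ℝ) → ENNReal :=
    fun o => ∏ p ∈ T, ENNReal.ofReal (Real.exp (θ * (o p) ^ 2)) with hg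
  have hfm : Measurable f := Finset.measurable_prod _ fun i _ => by fun_prop
  have hgm : Measurable g := Finset.measurable_prod _ fun i _ => by fun_prop
  have hTc : T.card ≤ k * k := by
    rw [hT, Finset.card_subtype]
    refine (Finset.card_filter_le _ _).trans ?_
    rw [Finset.card_product, hS]
  have hfg : ∀ d o, f d * g o = ENNReal.ofReal (Real.exp (θ / 2 *
      ∑ i ∈ S, ∑ j ∈ S, goeMatrix n d o i j ^ 2)) := by
    intro d o
    rw [goe_sum_sq, hf, hg]
    simp only
    rw [← ENNReal.ofReal_prod_of_nonneg fun _ _ => (Real.exp_pos _).le,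
      ← ENNReal.ofReal_prod_of_nonneg fun _ _ => (Real.exp_pos _).le,
      ← Real.exp_sum, ← Real.exp_sum, ← ENNReal.ofReal_mul (Real.exp_pos _).le, ← Real.exp_add,
      ← Finset.mul_sum, ← Finset.mul_sum]
    congr 2
    ring
  set P := (Measure.pi fun _ : Fin n => gaussianReal 0 1).prod
      (Measure.pi fun _ : {p : Fin n × Fin n // p.1 < p.2} => gaussianReal 0 (1 / 2)) with hP
  have hI : ∫⁻ z, f z.1 * g z.2 ∂P ≤ M ^ (k + k * k) := by
    rw [hP, lintegral_prod_mul hfm.aemeasurable hgm.aemeasurable, hf, hg,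
      goe_lintegral_pi _ (fun x => ENNReal.ofReal (Real.exp (θ / 2 * x ^ 2))) (by fun_prop),
      goe_lintegral_pi _ (fun x => ENNReal.ofReal (Real.exp (θ * x ^ 2))) (by fun_prop),
      ← hK1, ← hK2, hS, pow_add]
    refine mul_le_mul' (pow_le_pow_left' ((le_max_left _ _).trans (le_max_right _ _)) _) ?_
    exact (pow_le_pow_left' ((le_max_right _ _).trans (le_max_right _ _)) _).trans
      (pow_le_pow_right' hM1 hTc)
  have hMk := mul_meas_ge_le_lintegral (μ := P)
    (f := fun z => f z.1 * g z.2) (by fun_prop) (ENNReal.ofReal (Real.exp (θ / 2 * R)))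
  have hsub : (fun dq : (Fin n → ℝ) × ({p : Fin n × Fin n // p.1 < p.2} → ℝ) =>
      goeMatrix n dq.1 dq.2) ⁻¹' {Q | R ≤ ∑ i ∈ S, ∑ j ∈ S, Q i j ^ 2} ⊆
      {z | ENNReal.ofReal (Real.exp (θ / 2 * R)) ≤ f z.1 * g z.2} := by
    intro z hz
    simp only [Set.mem_ofPred_eq, hfg]
    refine ENNReal.ofReal_le_ofReal (Real.exp_le_exp.2 ?_)
    exact mul_le_mul_of_nonneg_left hz (by linarith)
  refine (measure_mono hsub).trans ?_
  rw [mul_comm (ENNReal.toReal _), ENNReal.ofReal_mul (Real.exp_pos _).le,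
    ENNReal.ofReal_toReal (by exact ENNReal.pow_ne_top hMtop.ne)]
  have hone : ENNReal.ofReal (Real.exp (-(θ / 2 * R))) * ENNReal.ofReal (Real.exp (θ / 2 * R)) = 1 := by
    rw [← ENNReal.ofReal_mul (Real.exp_pos _).le, ← Real.exp_add]; simp
  calc _ = ENNReal.ofReal (Real.exp (-(θ / 2 * R))) * (ENNReal.ofReal (Real.exp (θ / 2 * R)) *
        P {z | ENNReal.ofReal (Real.exp (θ / 2 * R)) ≤ f z.1 * g z.2}) := by
        rw [← mul_assoc, hone, one_mul]
    _ ≤ _ := by gcongr; exact hMk.trans hI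

lemma goe_gauss_lower (L : ℝ) (hL : 0 ≤ L) :
    (√(2 * Real.pi))⁻¹ * Real.exp (-(L + 1) ^ 2 / 2) ≤ (gaussianReal 0 1).real (Set.Iic (-L)) := by
  have hsub : Set.Icc (-(L + 1)) (-L) ⊆ Set.Iic (-L) := fun x hx => hx.2
  refine le_trans ?_ (measureReal_mono hsub)
  rw [measureReal_def, gaussianReal_apply_eq_integral _ one_ne_zero, ENNReal.toReal_ofReal
    (integral_nonneg fun x => gaussianPDFReal_nonneg _ _ _)]
  have hc : ∫ x in Set.Icc (-(L + 1)) (-L), (√(2 * Real.pi))⁻¹ * Real.exp (-(L + 1) ^ 2 / 2) =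
      (√(2 * Real.pi))⁻¹ * Real.exp (-(L + 1) ^ 2 / 2) := by
    simp
  rw [← hc]
  refine setIntegral_mono_on (integrableOn_const (by simp)) (integrable_gaussianPDFReal _ _).integrableOn
    measurableSet_Icc fun x hx => ?_
  simp only [gaussianPDFReal, NNReal.coe_one, mul_one, sub_zero]
  have h1 : x ^ 2 ≤ (L + 1) ^ 2 := by nlinarith [hx.1, hx.2]
  have h2 : -(L + 1) ^ 2 / 2 ≤ -x ^ 2 / 2 := by linarith
  gcongr

lemma goe_diag (n : ℕ) (L : ℝ) (hL : 0 ≤ L) :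
    goeMeasure n {Q | ∀ i, -L < Q i i} ≤
      ENNReal.ofReal (Real.exp (-(n * ((√(2 * Real.pi))⁻¹ * Real.exp (-(L + 1) ^ 2 / 2))))) := by
  have hmeas : MeasurableSet {Q : Matrix (Fin n) (Fin n) ℝ | ∀ i, -L < Q i i} := by
    simp only [Set.ofPred_forall]
    exact MeasurableSet.iInter fun i =>
      measurableSet_lt measurable_const (goe_entry_measurable n i i)
  unfold goeMeasure
  rw [Measure.map_apply (goeMatrix_measurable n) hmeas]
  have hpre : (fun dq : (Fin n → ℝ) × ({p : Fin n × Fin n // p.1 < p.2} → ℝ) =>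
      goeMatrix n dq.1 dq.2) ⁻¹' {Q | ∀ i, -L < Q i i} =
      (Set.univ.pi fun _ : Fin n => Set.Ioi (-L)) ×ˢ Set.univ := by
    ext z; simp [goeMatrix, Set.mem_pi]
  rw [hpre, Measure.prod_prod, Measure.pi_pi, measure_univ, mul_one]
  simp only [Finset.prod_const, Finset.card_univ, Fintype.card_fin]
  set p := (√(2 * Real.pi))⁻¹ * Real.exp (-(L + 1) ^ 2 / 2)
  have h1 : gaussianReal 0 1 (Set.Ioi (-L)) ≤ ENNReal.ofReal (Real.exp (-p)) := by
    rw [← ofReal_measureReal]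
    refine ENNReal.ofReal_le_ofReal ?_
    have h2 := goe_gauss_lower L hL
    have h3 : (gaussianReal 0 1).real (Set.Ioi (-L)) = 1 - (gaussianReal 0 1).real (Set.Iic (-L)) := by
      rw [← Set.compl_Iic, measureReal_compl measurableSet_Iic]; simp
    have := Real.add_one_le_exp (-p)
    linarith
  refine (pow_le_pow_left' h1 n).trans (le_of_eq ?_)
  rw [← ENNReal.ofReal_pow (Real.exp_pos _).le, ← Real.exp_nat_mul]
  congr 2; ring

lemma goe_union (k : ℕ) (θ : ℝ) (hθ0 : 0 ≤ θ) (hθ : θ < 1) :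
    ∃ C : ℝ, 0 ≤ C ∧ ∀ (n : ℕ) (L : ℝ), 0 ≤ L →
      (goeMeasure n {Q | ∃ x ∈ stdSimplex ℝ (Fin n),
          (∀ y ∈ stdSimplex ℝ (Fin n), x ⬝ᵥ Q.mulVec x ≤ y ⬝ᵥ Q.mulVec y) ∧
          {i | 0 < x i}.ncard = k}).toReal ≤
        Real.exp (-(n * ((√(2 * Real.pi))⁻¹ * Real.exp (-(L + 1) ^ 2 / 2)))) +
        (n : ℝ) ^ k * (C * Real.exp (-(θ / 2 * ((2 * (k : ℝ) - 1) * L ^ 2)))) := by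
  obtain ⟨C, hC0, hC⟩ := goe_chernoff k θ hθ0 hθ
  refine ⟨C, hC0, fun n L hL => ?_⟩
  refine ENNReal.toReal_le_of_le_ofReal (by positivity) ?_
  set R := (2 * (k : ℝ) - 1) * L ^ 2
  have hle : goeMeasure n {Q | ∃ x ∈ stdSimplex ℝ (Fin n),
          (∀ y ∈ stdSimplex ℝ (Fin n), x ⬝ᵥ Q.mulVec x ≤ y ⬝ᵥ Q.mulVec y) ∧
          {i | 0 < x i}.ncard = k} ≤ goeMeasure n ({Q | ∀ i, -L < Q i i} ∪
          ⋃ S ∈ Finset.powersetCard k (Finset.univ : Finset (Fin n)),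
            {Q | R ≤ ∑ i ∈ S, ∑ j ∈ S, Q i j ^ 2}) := by
    refine measure_mono_ae ?_
    filter_upwards [goe_ae_symm n] with Q hsymm hQ
    obtain ⟨x, hx, hmin, hcard⟩ := hQ
    by_cases h : ∀ i, -L < Q i i
    · exact Or.inl h
    · right
      push Not at h
      obtain ⟨l, hl⟩ := h
      obtain ⟨S, hS, hSR⟩ := goe_det Q hsymm x hx hmin hcard L hL l hl
      exact Set.mem_iUnion₂.2 ⟨S, hS, hSR⟩
  refine hle.trans ((measure_union_le _ _).trans ?_)
  rw [ENNReal.ofReal_add (by positivity) (by positivity)]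
  refine add_le_add (goe_diag n L hL) ((measure_biUnion_finset_le _ _).trans ?_)
  refine (Finset.sum_le_sum fun S hS =>
    hC n S (Finset.mem_powersetCard.1 hS).2 R).trans ?_
  rw [Finset.sum_const, Finset.card_powersetCard, Finset.card_univ, Fintype.card_fin,
    nsmul_eq_mul, ENNReal.ofReal_mul (p := (n : ℝ) ^ k) (by positivity), ENNReal.ofReal_pow (by positivity),
    ENNReal.ofReal_natCast]
  gcongr
  exact_mod_cast Nat.choose_le_pow n k

set_option maxHeartbeats 1000000 in
lemma goe_main (k : ℕ) (hk : 3 ≤ k) :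
    ∃ C : ℝ, ∀ᶠ n : ℕ in atTop,
      (goeMeasure n {Q | ∃ x ∈ stdSimplex ℝ (Fin n),
          (∀ y ∈ stdSimplex ℝ (Fin n), x ⬝ᵥ Q.mulVec x ≤ y ⬝ᵥ Q.mulVec y) ∧
          {i | 0 < x i}.ncard = k}).toReal ≤
        C * (n : ℝ) ^ (2 - (k : ℝ) - 2 / ((k : ℝ) + 1)) *
          (Real.log n) ^ ((k : ℝ) - 3 / 2 + 1 / ((k : ℝ) + 1)) := by
  have hk3 : (3 : ℝ) ≤ k := by exact_mod_cast hk
  set κ : ℝ := (k : ℝ) with hκ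
  set ε : ℝ := 1 / (12 * κ) with hε
  have hεκ : ε * κ = 1 / 12 := by rw [hε]; field_simp
  have hε0 : 0 < ε := by positivity
  have hε1 : ε ≤ 1 / 36 := by nlinarith
  obtain ⟨C, hC0, hC⟩ := goe_union k (1 - ε) (by linarith) (by linarith)
  set a : ℝ := 2 - κ - 2 / (κ + 1) with ha
  set b : ℝ := κ - 3 / 2 + 1 / (κ + 1) with hb
  have hfrac : 2 / (κ + 1) ≤ 1 / 2 := by rw [div_le_iff₀ (by linarith)]; linarith
  have hb0 : 0 ≤ b := by
    have : 0 ≤ 1 / (κ + 1) := by positivity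
    rw [hb]; linarith
  set c : ℝ := (√(2 * Real.pi))⁻¹ with hc
  have hc0 : 0 < c := by positivity
  have hlog : Tendsto (fun n : ℕ => Real.log n) atTop atTop :=
    Real.tendsto_log_atTop.comp tendsto_natCast_atTop_atTop
  have hev : ∀ᶠ l : ℝ in atTop, κ * l ≤ c * Real.exp (ε * l) := by
    have h := (isLittleO_pow_exp_pos_mul_atTop 1 hε0).bound (c := c / κ) (by positivity)
    filter_upwards [h, eventually_ge_atTop 0] with l hl hl0
    rw [pow_one, Real.norm_of_nonneg hl0, Real.norm_of_nonneg (Real.exp_pos _).le] at hl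
    calc κ * l ≤ κ * (c / κ * Real.exp (ε * l)) := by gcongr
      _ = c * Real.exp (ε * l) := by field_simp
  refine ⟨1 + C, ?_⟩
  filter_upwards [hlog.eventually hev, hlog.eventually (eventually_ge_atTop ((2 / ε) ^ 2)),
    eventually_gt_atTop 0] with n h1 h2 hn
  have hn0 : (0 : ℝ) < n := by exact_mod_cast hn
  set l := Real.log n with hl
  have hnl : (n : ℝ) = Real.exp l := (Real.exp_log hn0).symm
  have h2ε : 1 ≤ 2 / ε := by rw [le_div_iff₀ hε0]; linarith
  have hl1 : 1 ≤ l := by nlinarith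
  set w := √(2 * (1 - ε) * l) with hw
  have hw2 : w ^ 2 = 2 * (1 - ε) * l := Real.sq_sqrt (by nlinarith)
  have hwε : 2 / ε ≤ w := by
    rw [hw]; refine Real.le_sqrt_of_sq_le (h2.trans ?_); nlinarith
  have hεw : 2 ≤ ε * w := by rw [div_le_iff₀ hε0] at hwε; linarith
  have hL0 : 0 ≤ w - 1 := by linarith
  have hL2 : (1 - ε) * w ^ 2 ≤ (w - 1) ^ 2 := by nlinarith
  refine (hC n (w - 1) hL0).trans ?_
  have hlb : 1 ≤ l ^ b := Real.one_le_rpow hl1 hb0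
  have hna : (n : ℝ) ^ a = Real.exp (a * l) := by
    rw [Real.rpow_def_of_pos hn0, mul_comm]
  have t1 : Real.exp (-((n : ℝ) * (c * Real.exp (-(w - 1 + 1) ^ 2 / 2)))) ≤ Real.exp (a * l) := by
    have : (n : ℝ) * (c * Real.exp (-(w - 1 + 1) ^ 2 / 2)) = c * Real.exp (ε * l) := by
      rw [sub_add_cancel, neg_div, hw2, hnl, mul_left_comm, ← Real.exp_add]
      congr 2; ring
    rw [this, Real.exp_le_exp]
    have : 0 ≤ (a + κ) * l := mul_nonneg (by rw [ha]; linarith) (by linarith)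
    linarith
  have t2 : (n : ℝ) ^ k * (C * Real.exp (-((1 - ε) / 2 * ((2 * κ - 1) * (w - 1) ^ 2)))) ≤
      C * Real.exp (a * l) := by
    rw [hnl, ← Real.exp_nat_mul, mul_left_comm, ← Real.exp_add]
    refine mul_le_mul_of_nonneg_left (Real.exp_le_exp.2 ?_) hC0
    rw [← hκ]
    have h3 : (1 - ε) / 2 * ((2 * κ - 1) * ((1 - ε) * w ^ 2)) ≤
        (1 - ε) / 2 * ((2 * κ - 1) * (w - 1) ^ 2) := by
      have : 0 ≤ 1 - ε := by linarith
      have : 0 ≤ 2 * κ - 1 := by linarith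
      gcongr
    rw [hw2] at h3
    have h4 : 1 - 3 * ε ≤ (1 - ε) ^ 3 := by
      have : 0 ≤ ε ^ 2 * (3 - ε) := mul_nonneg (sq_nonneg _) (by linarith)
      linarith [this, (by ring : (1 - ε) ^ 3 = 1 - 3 * ε + ε ^ 2 * (3 - ε))]
    have h5 : κ - a ≤ (1 - ε) ^ 3 * (2 * κ - 1) := by
      have : (1 - 3 * ε) * (2 * κ - 1) ≤ (1 - ε) ^ 3 * (2 * κ - 1) :=
        mul_le_mul_of_nonneg_right h4 (by linarith)
      have h6 : (1 - 3 * ε) * (2 * κ - 1) = 2 * κ - 1 - 6 * (ε * κ) + 3 * ε := by ring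
      rw [h6, hεκ] at this
      rw [ha]; linarith
    have h7 := mul_le_mul_of_nonneg_right h5 (by linarith : (0 : ℝ) ≤ l)
    have h8 : (1 - ε) / 2 * ((2 * κ - 1) * ((1 - ε) * (2 * (1 - ε) * l))) =
        (1 - ε) ^ 3 * (2 * κ - 1) * l := by ring
    linarith
  rw [hna]
  calc _ ≤ Real.exp (a * l) + C * Real.exp (a * l) := add_le_add t1 t2
    _ = (1 + C) * Real.exp (a * l) * 1 := by ring
    _ ≤ _ := by gcongr

/-- Fixed-support tail bound: for fixed `k ≥ 3`, the GOE probability that some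
global minimizer has support of cardinality exactly `k` is eventually at most
`C_k · n^{2−k−2/(k+1)} (log n)^{k−3/2+1/(k+1)}`; in particular, for `k = 3` it
is eventually at most `C (log n)^{7/4} / n^{3/2}`. -/
theorem goe_support_k_tail_bound (k : ℕ) (hk : 3 ≤ k) :
    (∃ C : ℝ, ∀ᶠ n : ℕ in atTop,
      (goeMeasure n {Q | ∃ x ∈ stdSimplex ℝ (Fin n),
          (∀ y ∈ stdSimplex ℝ (Fin n), x ⬝ᵥ Q.mulVec x ≤ y ⬝ᵥ Q.mulVec y) ∧
          {i | 0 < x i}.ncard = k}).toReal ≤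
        C * (n : ℝ) ^ (2 - (k : ℝ) - 2 / ((k : ℝ) + 1)) *
          (Real.log n) ^ ((k : ℝ) - 3 / 2 + 1 / ((k : ℝ) + 1))) ∧
    (∃ C : ℝ, ∀ᶠ n : ℕ in atTop,
      (goeMeasure n {Q | ∃ x ∈ stdSimplex ℝ (Fin n),
          (∀ y ∈ stdSimplex ℝ (Fin n), x ⬝ᵥ Q.mulVec x ≤ y ⬝ᵥ Q.mulVec y) ∧
          {i | 0 < x i}.ncard = 3}).toReal ≤
        C * (Real.log n) ^ ((7 : ℝ) / 4) / (n : ℝ) ^ ((3 : ℝ) / 2)) := by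
  refine ⟨goe_main k hk, ?_⟩
  obtain ⟨C, hC⟩ := goe_main 3 le_rfl
  refine ⟨C, hC.mono fun n hn => hn.trans (le_of_eq ?_)⟩
  have e1 : (2 - ((3 : ℕ) : ℝ) - 2 / (((3 : ℕ) : ℝ) + 1)) = -(3 / 2) := by norm_num
  have e2 : (((3 : ℕ) : ℝ) - 3 / 2 + 1 / (((3 : ℕ) : ℝ) + 1)) = 7 / 4 := by norm_num
  rw [e1, e2, Real.rpow_neg (Nat.cast_nonneg n)]
  ring
end
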